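/- arXiv:2309.13615 — 2 statements merged into one kernel-verified Lean document; each statement's English description precedes it below -/
import Mathlib

section
/- For every r-colored composition (α,ε) of n, the colored ribbon Schur function expands Schur-positively as r_{(α,ε)} = Σ_{𝛌 ⊢ n} c_𝛌(α,ε) s_𝛌, where the sum is over all r-partite partitions 𝛌 of n and c_𝛌(α,ε) is the number of standard Young r-partite tableaux Q of shape 𝛌 with colored descent composition co(Q) = (α,ε). -/
/-- Auxiliary construction of the cells of a ribbon: each part of the list
contributes a row, rows are read from bottom to top (in English (row, column)
coordinates the row coordinate decreases as we go up), and each new row starts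
in the column of the last cell of the previous row. -/
def ribbonAux : List ℕ → ℤ × ℤ → Finset (ℤ × ℤ)
  | [], _ => ∅
  | a :: rest, p =>
      ((Finset.range a).image fun j : ℕ => (p.1, p.2 + (j : ℤ))) ∪
        ribbonAux rest (p.1 - 1, p.2 + (a : ℤ) - 1)

/-- The cells of the ribbon (zigzag diagram) whose row lengths, read from
bottom to top, are the entries of `l`. -/
def ribbonOfList (l : List ℕ) : Finset (ℤ × ℤ) := ribbonAux l (0, 0)
/-- The rainbow decomposition of a colored list: the unique way of grouping
adjacent entries of equal color into maximal monochromatic blocks.  Each block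
is recorded as (list of first components, common color). -/
def rainbow {r : ℕ} : List (ℕ × Fin r) → List (List ℕ × Fin r)
  | [] => []
  | (a, c) :: rest =>
    match rainbow rest with
    | [] => [([a], c)]
    | (b, c') :: bs =>
        if c = c' then (a :: b, c') :: bs else ([a], c) :: (b, c') :: bs
/-- The direct sum `A ⊕ B` of two (skew) shapes given by their cell sets: `B`
is translated so that its lower-left vertex coincides with the upper-right
vertex of `A` (in English coordinates, where the row coordinate increases
downwards). -/
noncomputable def dsum (A B : Finset (ℤ × ℤ)) : Finset (ℤ × ℤ) :=
  if hA : A.Nonempty then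
    if hB : B.Nonempty then
      A ∪ B.image fun c =>
        (c.1 - (B.image Prod.fst).max' (hB.image _) + (A.image Prod.fst).min' (hA.image _) - 1,
         c.2 - (B.image Prod.snd).min' (hB.image _) + (A.image Prod.snd).max' (hA.image _) + 1)
    else A
  else B

/-- The colored zigzag shape `Z_{(α,ε)}` of a colored composition: the ribbons
of the blocks of the rainbow decomposition, with their colors. -/
def zigzagOf {r : ℕ} (l : List (ℕ × Fin r)) : List (Finset (ℤ × ℤ) × Fin r) :=
  (rainbow l).map fun b => (ribbonOfList b.1, b.2)

/-- The `r`-partite skew shape `λ_{Z_{(α,ε)}}` associated with a colored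
composition: its part of color `j` is the direct sum of the ribbons of color
`j` of the colored zigzag shape `Z_{(α,ε)}`, in order. -/
noncomputable def partiteShape {r : ℕ} (l : List (ℕ × Fin r)) :
    Fin r → Finset (ℤ × ℤ) := fun j =>
  ((((zigzagOf l).filter fun p => p.2 = j)).map Prod.fst).foldl dsum ∅

/-- `T` is a standard Young `r`-partite tableau of the `r`-partite shape `sh`
with `n` cells in total: each part is zero off its shape, entries are in
`{1, …, n}`, every element of `{1, …, n}` appears exactly once in exactly one
part, and each part increases along rows and down columns. -/
def IsPartiteSYT {r : ℕ} (sh : Fin r → Finset (ℤ × ℤ)) (n : ℕ)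
    (T : Fin r → ℤ × ℤ → ℕ) : Prop :=
  (∀ j, ∀ c ∉ sh j, T j c = 0) ∧
  (∀ j, ∀ c ∈ sh j, T j c ∈ Finset.Icc 1 n) ∧
  (∀ m ∈ Finset.Icc 1 n, ∃! p : Fin r × (ℤ × ℤ), p.2 ∈ sh p.1 ∧ T p.1 p.2 = m) ∧
  (∀ j, ∀ c ∈ sh j, (c.1, c.2 + 1) ∈ sh j → T j c < T j (c.1, c.2 + 1)) ∧
  (∀ j, ∀ c ∈ sh j, (c.1 + 1, c.2) ∈ sh j → T j c < T j (c.1 + 1, c.2))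
/-- The (skew) Schur function of the shape with cell set `D`, in the variables
`x^{(j)}_i` of color `j` (inside the ring of power series in all `r` sets of
variables): the generating function of semistandard fillings of `D`. -/
noncomputable def skewSchurIn {r : ℕ} (j : Fin r) (D : Finset (ℤ × ℤ)) :
    MvPowerSeries (Fin r × ℕ) ℤ := fun d =>
  (({T : ℤ × ℤ → ℕ |
      (∀ c ∉ D, T c = 0) ∧
      (∀ c ∈ D, (c.1, c.2 + 1) ∈ D → T c ≤ T (c.1, c.2 + 1)) ∧
      (∀ c ∈ D, (c.1 + 1, c.2) ∈ D → T c < T (c.1 + 1, c.2)) ∧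
      (∑ c ∈ D, Finsupp.single (j, T c) 1) = d}).ncard : ℤ)
/-- The colored ribbon Schur function of the colored composition `l` with
rainbow decomposition `(α_{(1)},ε_{(1)}) ⋯ (α_{(m)},ε_{(m)})`:
`r_{(α,ε)} = r_{α_{(1)}}(x^{(ε_{(1)})}) ⋯ r_{α_{(m)}}(x^{(ε_{(m)})})`. -/
noncomputable def colRibbon {r : ℕ} (l : List (ℕ × Fin r)) :
    MvPowerSeries (Fin r × ℕ) ℤ :=
  ((rainbow l).map fun b => skewSchurIn b.2 (ribbonOfList b.1)).prod
open Classical in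
/-- The color of the part of the `r`-partite tableau `T` containing the entry
`m` (and `0` if there is no such part). -/
noncomputable def tabColor {r : ℕ} [NeZero r] (sh : Fin r → Finset (ℤ × ℤ))
    (T : Fin r → ℤ × ℤ → ℕ) (m : ℕ) : Fin r :=
  if h : ∃ p : Fin r × (ℤ × ℤ), p.2 ∈ sh p.1 ∧ T p.1 p.2 = m then
    (Classical.choose h).1
  else 0

open Classical in
/-- The set `S⁺ = S ∪ {n}` underlying the colored descent set of an
`r`-partite tableau `T` with entries `1, …, n`. -/
noncomputable def sDesPlusTab {r : ℕ} (sh : Fin r → Finset (ℤ × ℤ)) (n : ℕ)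
    (T : Fin r → ℤ × ℤ → ℕ) : Finset ℕ :=
  (Finset.Icc 1 n).filter fun i =>
    i = n ∨ ∃ j, ∃ c ∈ sh j, ∃ j', ∃ c' ∈ sh j',
      T j c = i ∧ T j' c' = i + 1 ∧ (j ≠ j' ∨ c.1 < c'.1)

/-- The colored descent composition `co(Q)` of an `r`-partite tableau: the
colored composition whose parts are the successive differences of the elements
of `S⁺ = sDes(Q) ∪ {n}` and whose colors are the colors of the parts containing
those entries. -/
noncomputable def coTab {r : ℕ} [NeZero r] (sh : Fin r → Finset (ℤ × ℤ))
    (n : ℕ) (T : Fin r → ℤ × ℤ → ℕ) : List (ℕ × Fin r) :=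
  let L := (sDesPlusTab sh n T).sort (· ≤ ·)
  (List.range L.length).map fun k =>
    (L.getD k 0 - (if k = 0 then 0 else L.getD (k - 1) 0),
      tabColor sh T (L.getD k 0))

/-- The `r`-partite shape (in `ℤ × ℤ` cells) of an `r`-partite partition,
given as a tuple of Young diagrams. -/
def shOf {r : ℕ} (lam : Fin r → YoungDiagram) : Fin r → Finset (ℤ × ℤ) :=
  fun j => (lam j).cells.image fun c => ((c.1 : ℤ), (c.2 : ℤ))

/-! ### Semistandard tableaux as triangular arrays, and row insertion

A semistandard tableau with entries `< N` is encoded by the array `f`, where `f i t` is the number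
of entries `< t` in row `i`. -/

/-- The interlacing conditions on the array `f` of a semistandard tableau with entries `< N`. -/
structure IsGT (N : ℕ) (f : ℕ → ℕ → ℕ) : Prop where
  zero : ∀ i, f i 0 = 0
  mono : ∀ i t, f i t ≤ f i (t + 1)
  inter : ∀ i t, f (i + 1) (t + 1) ≤ f i t
  const : ∀ i t, N ≤ t → f i (t + 1) = f i t

/-- The row in which the array at level `t` (that is, the tableau of the entries `< t`) gains a
cell when `a` is inserted. -/
def bumpRow (f : ℕ → ℕ → ℕ) (a : ℕ) : ℕ → ℕ
  | 0 => 0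
  | t + 1 =>
    if t ≤ a then 0
    else if f (bumpRow f a t) t = f (bumpRow f a t) (t + 1) then bumpRow f a t
    else bumpRow f a t + 1

/-- Row insertion of `a`. -/
def rowInsert (f : ℕ → ℕ → ℕ) (a i t : ℕ) : ℕ :=
  f i t + if a < t ∧ bumpRow f a t = i then 1 else 0

theorem bumpRow_of_le {f : ℕ → ℕ → ℕ} {a t : ℕ} (h : t ≤ a + 1) : bumpRow f a t = 0 := by
  cases t with
  | zero => rfl
  | succ t => simp only [bumpRow]; rw [if_pos (by omega)]

theorem bumpRow_succ {f : ℕ → ℕ → ℕ} {a t : ℕ} (h : a < t) :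
    bumpRow f a (t + 1) =
      if f (bumpRow f a t) t = f (bumpRow f a t) (t + 1) then bumpRow f a t
      else bumpRow f a t + 1 := by
  simp only [bumpRow]; rw [if_neg (by omega)]

namespace IsGT

variable {N : ℕ} {f g : ℕ → ℕ → ℕ} {a b : ℕ}

theorem antitone_row (hf : IsGT N f) (i t : ℕ) : f (i + 1) t ≤ f i t :=
  (hf.mono _ _).trans (hf.inter _ _)

theorem mono_le (hf : IsGT N f) (i : ℕ) : Monotone (f i) := monotone_nat_of_le_succ (hf.mono i)

theorem eq_of_le (hf : IsGT N f) (i : ℕ) {t : ℕ} (h : N ≤ t) : f i t = f i N := by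
  induction t, h using Nat.le_induction with
  | base => rfl
  | succ t ht ih => rw [hf.const _ _ ht, ih]

theorem eq_zero_of_le (hf : IsGT N f) {i t : ℕ} (h : t ≤ i) : f i t = 0 := by
  induction t generalizing i with
  | zero => exact hf.zero i
  | succ t ih =>
    obtain ⟨i, rfl⟩ : ∃ k, i = k + 1 := ⟨i - 1, by omega⟩
    have := hf.inter i t
    have := ih (i := i) (by omega)
    omega

theorem bumpRow_eq_of_le (hf : IsGT N f) (ha : a < N) {t : ℕ} (h : N ≤ t) :
    bumpRow f a t = bumpRow f a N := by
  induction t, h using Nat.le_induction with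
  | base => rfl
  | succ t ht ih => rw [bumpRow_succ (by omega), if_pos (hf.const _ _ ht).symm, ih]

theorem rowInsert (hf : IsGT N f) (ha : a < N) : IsGT N (rowInsert f a) := by
  have hmono : ∀ i t, _root_.rowInsert f a i t ≤ _root_.rowInsert f a i (t + 1) := by
    intro i t
    unfold _root_.rowInsert
    have := hf.mono i t
    by_cases hat : a < t
    · rw [bumpRow_succ hat]
      grind
    · simp only [hat]; grind
  have key : ∀ t i, _root_.rowInsert f a (i + 1) t ≤ _root_.rowInsert f a i t ∧
      _root_.rowInsert f a (i + 1) (t + 1) ≤ _root_.rowInsert f a i t := by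
    intro t
    have step : ∀ t, (∀ i, _root_.rowInsert f a (i + 1) t ≤ _root_.rowInsert f a i t) →
        ∀ i, _root_.rowInsert f a (i + 1) (t + 1) ≤ _root_.rowInsert f a i t := by
      intro t ih i
      have h1 := ih i
      unfold _root_.rowInsert at h1 ⊢
      have := hf.inter i t
      by_cases hat : a < t
      · rw [bumpRow_succ hat]
        grind
      · by_cases hat' : a < t + 1
        · rw [bumpRow_of_le (t := t + 1) (by omega)]
          grind
        · simp only [hat, hat']; grind
    induction t with
    | zero =>
      have h0 : ∀ i, _root_.rowInsert f a (i + 1) 0 ≤ _root_.rowInsert f a i 0 := by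
        intro i; simp [_root_.rowInsert, hf.zero]
      exact fun i => ⟨h0 i, step 0 h0 i⟩
    | succ t ih =>
      have h0 : ∀ i, _root_.rowInsert f a (i + 1) (t + 1) ≤ _root_.rowInsert f a i (t + 1) :=
        fun i => (ih i).2.trans (hmono i t)
      exact fun i => ⟨h0 i, step _ h0 i⟩
  refine ⟨fun i => by simp [_root_.rowInsert, hf.zero], hmono, fun i t => (key t i).2, ?_⟩
  intro i t ht
  unfold _root_.rowInsert
  rw [hf.bumpRow_eq_of_le ha ht, hf.bumpRow_eq_of_le ha (t := t + 1) (by omega), hf.const i t ht]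
  have h1 : a < t := by omega
  have h2 : a < t + 1 := by omega
  simp [h1, h2]

theorem bumpRow_lt (hf : IsGT N f) (ha : a < N) (t : ℕ) : bumpRow f a t < N := by
  have hN : bumpRow f a N < N := by
    by_contra h
    have h1 := (hf.rowInsert ha).eq_zero_of_le (i := bumpRow f a N) (t := N) (by omega)
    simp [_root_.rowInsert, ha] at h1
  have hm : Monotone (bumpRow f a) := by
    refine monotone_nat_of_le_succ fun t => ?_
    by_cases h : a < t
    · rw [bumpRow_succ h]; split_ifs <;> omega
    · rw [bumpRow_of_le (by omega)]; omega
  rcases le_total t N with h | h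
  · exact (hm h).trans_lt hN
  · rwa [hf.bumpRow_eq_of_le ha h]

theorem bumpRow_le_of_le (hab : a ≤ b) {t : ℕ} (ht : b < t) :
    bumpRow (_root_.rowInsert f a) b t ≤ bumpRow f a t := by
  induction t, ht using Nat.le_induction with
  | base => rw [bumpRow_of_le le_rfl]; omega
  | succ t ht ih =>
    rw [bumpRow_succ (by omega : b < t), bumpRow_succ (by omega : a < t)]
    have h1 : a < t := by omega
    have h2 : a < t + 1 := by omega
    have h3 := bumpRow_succ (f := f) h1
    simp only [_root_.rowInsert, h1, h2, true_and]
    rcases ih.lt_or_eq with h | h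
    · split_ifs <;> omega
    · grind

theorem lt_bumpRow_of_lt (hf : IsGT N f) (hab : b < a) {t : ℕ} (ht : a < t) :
    bumpRow f a t < bumpRow (_root_.rowInsert f a) b t := by
  induction t, ht using Nat.le_induction with
  | base =>
    have h1 : bumpRow f a (a + 1) = 0 := bumpRow_of_le le_rfl
    rw [bumpRow_succ hab, h1]
    have := hf.mono 0 a
    simp only [_root_.rowInsert]
    grind
  | succ t ht ih =>
    have h1 : a < t := by omega
    have h2 : a < t + 1 := by omega
    have h3 := bumpRow_succ (f := f) h1
    rw [bumpRow_succ (by omega : b < t)]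
    have := hf.mono (bumpRow f a t + 1) t
    simp only [_root_.rowInsert, h1, h2, true_and]
    grind

/-- The row bumping lemma. -/
theorem bumpRow_le_iff (hf : IsGT N f) (ha : a < N) (hb : b < N) :
    bumpRow (_root_.rowInsert f a) b N ≤ bumpRow f a N ↔ a ≤ b := by
  refine ⟨fun h => ?_, fun h => bumpRow_le_of_le h hb⟩
  by_contra hab
  exact absurd (hf.lt_bumpRow_of_lt (by omega) ha) (not_lt.2 h)

theorem bumpRow_unique_aux (hf : IsGT N f) (hg : IsGT N g)
    (h : _root_.rowInsert f a = _root_.rowInsert g b) {t : ℕ} (hat : a < t) (hbt : b < t)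
    (hk : bumpRow f a t = bumpRow g b t) :
    a = b ∧ ∀ s ≤ t, a < s → bumpRow f a s = bumpRow g b s := by
  induction t with
  | zero => omega
  | succ t ih =>
    have stay : ∀ {f : ℕ → ℕ → ℕ} {a : ℕ}, IsGT N f → a < t + 1 →
        ((a = t ∧ bumpRow f a (t + 1) = 0) ∨
          (a < t ∧ bumpRow f a (t + 1) = bumpRow f a t + 1)) ∧
          _root_.rowInsert f a (bumpRow f a (t + 1)) t <
            _root_.rowInsert f a (bumpRow f a (t + 1)) (t + 1) ∨
        (a < t ∧ bumpRow f a (t + 1) = bumpRow f a t) ∧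
          _root_.rowInsert f a (bumpRow f a (t + 1)) t =
            _root_.rowInsert f a (bumpRow f a (t + 1)) (t + 1) := by
      intro f a hf hat
      have hm := hf.mono
      rcases (by omega : a = t ∨ a < t) with rfl | h
      · left
        have h1 : bumpRow f a (a + 1) = 0 := bumpRow_of_le le_rfl
        have := hm 0 a
        simp only [_root_.rowInsert, h1]
        grind
      · have h3 := bumpRow_succ (f := f) h
        have := hm (bumpRow f a t + 1) t
        simp only [_root_.rowInsert]
        grind
    have h1 := stay hf hat
    have h2 := stay hg hbt
    rw [← h, ← hk] at h2
    have fin : a < t → b < t → bumpRow f a t = bumpRow g b t →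
        a = b ∧ ∀ s ≤ t + 1, a < s → bumpRow f a s = bumpRow g b s := by
      intro ha hb hk'
      obtain ⟨e, h'⟩ := ih ha hb hk'
      refine ⟨e, fun s hs has => ?_⟩
      rcases (by omega : s ≤ t ∨ s = t + 1) with hs | rfl
      · exact h' s hs has
      · exact hk
    rcases h1 with ⟨h1, h1'⟩ | ⟨h1, h1'⟩ <;> rcases h2 with ⟨h2, h2'⟩ | ⟨h2, h2'⟩
    · rcases h1 with h1 | h1 <;> rcases h2 with h2 | h2
      · refine ⟨by omega, fun s hs has => ?_⟩
        obtain rfl : s = t + 1 := by omega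
        exact hk
      · omega
      · omega
      · exact fin h1.1 h2.1 (by omega)
    · omega
    · omega
    · exact fin h1.1 h2.1 (by omega)

/-- Row insertion is injective once the row of the new cell is recorded. -/
theorem rowInsert_inj (hf : IsGT N f) (hg : IsGT N g) (ha : a < N) (hb : b < N)
    (h : _root_.rowInsert f a = _root_.rowInsert g b) (hk : bumpRow f a N = bumpRow g b N) :
    f = g ∧ a = b := by
  have key : ∀ t, N ≤ t → a = b ∧ ∀ s ≤ t, a < s → bumpRow f a s = bumpRow g b s := by
    intro t ht
    refine bumpRow_unique_aux hf hg h (by omega) (by omega) ?_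
    rw [hf.bumpRow_eq_of_le ha ht, hg.bumpRow_eq_of_le hb ht, hk]
  obtain rfl := (key N le_rfl).1
  refine ⟨?_, rfl⟩
  ext i t
  have h1 := congrFun (congrFun h i) t
  have h2 := (key (max N t) (le_max_left _ _)).2 t (le_max_right _ _)
  simp only [_root_.rowInsert] at h1
  by_cases hat : a < t
  · rw [h2 hat] at h1; omega
  · simp only [hat, false_and, if_false] at h1; omega

theorem exists_bump_path (hf : IsGT N f) (t K : ℕ) (hK : f (K + 1) t < f K t) :
    ∃ a < t, ∃ k : ℕ → ℕ, k t = K ∧ k (a + 1) = 0 ∧ f 0 a < f 0 (a + 1) ∧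
      (∀ s, a < s → s ≤ t → f (k s + 1) s < f (k s) s) ∧
      ∀ s, a < s → s < t →
        (k (s + 1) = k s ∧ f (k s) s = f (k s) (s + 1)) ∨
        (k (s + 1) = k s + 1 ∧ f (k s + 1) s < f (k s + 1) (s + 1)) := by
  induction t generalizing K with
  | zero => have := hf.zero K; omega
  | succ t ih =>
    have ext : ∀ K', f (K' + 1) t < f K' t →
        ((K = K' ∧ f K' t = f K' (t + 1)) ∨
          (K = K' + 1 ∧ f (K' + 1) t < f (K' + 1) (t + 1))) →
        ∃ a < t + 1, ∃ k : ℕ → ℕ, k (t + 1) = K ∧ k (a + 1) = 0 ∧ f 0 a < f 0 (a + 1) ∧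
          (∀ s, a < s → s ≤ t + 1 → f (k s + 1) s < f (k s) s) ∧
          ∀ s, a < s → s < t + 1 →
            (k (s + 1) = k s ∧ f (k s) s = f (k s) (s + 1)) ∨
            (k (s + 1) = k s + 1 ∧ f (k s + 1) s < f (k s + 1) (s + 1)) := by
      intro K' h1 h2
      obtain ⟨a, hat, k, hk, hk0, h0, hc, hs⟩ := ih K' h1
      refine ⟨a, by omega, fun s => if s ≤ t then k s else K, ?_, ?_, h0, ?_, ?_⟩
      · simp
      · simp [hk0]; omega
      · intro s has hst
        by_cases h : s ≤ t
        · simpa [h] using hc s has h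
        · obtain rfl : s = t + 1 := by omega
          simpa using hK
      · intro s has hst
        by_cases h : s < t
        · have h' : s + 1 ≤ t := h
          simpa [h.le, h'] using hs s has h
        · obtain rfl : s = t := by omega
          simp only [le_refl, if_true, hk, Nat.not_succ_le_self, if_false]
          exact h2
    rcases (hf.mono K t).lt_or_eq with h | h
    · rcases K with _ | k
      · refine ⟨t, by omega, fun _ => 0, rfl, rfl, h, ?_, ?_⟩
        · intro s h1 h2
          obtain rfl : s = t + 1 := by omega
          exact hK
        · intros; omega
      · exact ext k (h.trans_le (hf.inter k t)) (Or.inr ⟨rfl, h⟩)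
    · exact ext K (by have := hf.mono (K + 1) t; omega) (Or.inl ⟨rfl, h⟩)

/-- Row insertion can be undone, starting from any removable cell. -/
theorem exists_rowInsert (hf : IsGT N f) {K : ℕ} (hK : f (K + 1) N < f K N) :
    ∃ g a, IsGT N g ∧ a < N ∧ _root_.rowInsert g a = f ∧ bumpRow g a N = K := by
  obtain ⟨a, haN, k', hkN, hk0, h0, hc', hs'⟩ := exists_bump_path hf N K hK
  obtain ⟨k, hk⟩ : ∃ k : ℕ → ℕ, ∀ s, k s = if s ≤ N then k' s else K := ⟨_, fun _ => rfl⟩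
  have hk1 : k (a + 1) = 0 := by rw [hk, if_pos (by omega), hk0]
  have hkN' : k N = K := by rw [hk, if_pos le_rfl, hkN]
  have hconst : ∀ s, N ≤ s → k s = K := by
    intro s hs
    rcases hs.eq_or_lt with rfl | h
    · exact hkN'
    · rw [hk, if_neg (by omega)]
  have hc : ∀ s, a < s → f (k s + 1) s < f (k s) s := by
    intro s has
    rcases le_total s N with h | h
    · rw [hk, if_pos h]; exact hc' s has h
    · rw [hconst s h, hf.eq_of_le _ h, hf.eq_of_le _ h]; exact hK
  have hs : ∀ s, a < s →
        (k (s + 1) = k s ∧ f (k s) s = f (k s) (s + 1)) ∨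
        (k (s + 1) = k s + 1 ∧ f (k s + 1) s < f (k s + 1) (s + 1)) := by
    intro s has
    rcases lt_or_ge s N with h | h
    · rw [hk s, hk (s + 1), if_pos h.le, if_pos (by omega)]; exact hs' s has h
    · left
      rw [hconst s h, hconst (s + 1) (by omega), hf.const _ _ h]; exact ⟨rfl, rfl⟩
  obtain ⟨g, hg⟩ : ∃ g : ℕ → ℕ → ℕ, ∀ i t, g i t = f i t - if a < t ∧ k t = i then 1 else 0 :=
    ⟨_, fun _ _ => rfl⟩
  have hbump : ∀ t, a < t → bumpRow g a t = k t := by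
    intro t ht
    induction t, ht using Nat.le_induction with
    | base => rw [bumpRow_of_le le_rfl, hk1]
    | succ t ht ih =>
      rw [bumpRow_succ (by omega), ih, hg, hg]
      have h1 := hs t (by omega)
      have h2 := hc t (by omega)
      have h3 := hf.mono (k t) t
      have h4 : a < t := by omega
      have h5 : a < t + 1 := by omega
      simp only [h4, h5, true_and, if_true]
      rcases h1 with ⟨h1, h6⟩ | ⟨h1, h6⟩ <;> rw [h1] <;> simp <;> omega
  refine ⟨g, a, ⟨?_, ?_, ?_, ?_⟩, haN, ?_, ?_⟩
  · intro i; rw [hg, hf.zero]; simp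
  · intro i t
    rw [hg, hg]
    have h3 := hf.mono i t
    rcases lt_trichotomy a t with h | rfl | h
    · have h1 := hs t h
      have h5 : a < t + 1 := by omega
      simp only [h, h5, true_and]
      rcases h1 with ⟨h1, h6⟩ | ⟨h1, h6⟩ <;> rw [h1] <;> split_ifs <;> subst_vars <;> omega
    · simp only [lt_irrefl, false_and, if_false, lt_add_one, true_and, hk1]
      split_ifs <;> subst_vars <;> omega
    · rw [if_neg (by omega), if_neg (by omega)]; omega
  · intro i t
    rw [hg, hg]
    have h3 := hf.inter i t
    rcases lt_trichotomy a t with h | rfl | h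
    · have h1 := hs t h
      have h2 := hc t h
      have h4 := hc (t + 1) (by omega)
      have h5 : a < t + 1 := by omega
      have h7 := hf.mono (k t + 1) t
      simp only [h, h5, true_and]
      rcases h1 with ⟨h1, h6⟩ | ⟨h1, h6⟩ <;> rw [h1] at h4 ⊢ <;> split_ifs <;> subst_vars <;> omega
    · simp only [lt_irrefl, false_and, if_false]; omega
    · rw [if_neg (by omega), if_neg (by omega)]; omega
  · intro i t ht
    rw [hg, hg, hconst t ht, hconst (t + 1) (by omega), hf.const _ _ ht]
    have h4 : a < t := by omega
    have h5 : a < t + 1 := by omega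
    simp [h4, h5]
  · ext i t
    simp only [_root_.rowInsert]
    by_cases hat : a < t
    · have h2 := hc t hat
      rw [hbump t hat, hg]
      split_ifs with h
      · obtain ⟨_, rfl⟩ := h; omega
      · omega
    · simp [hat, hg]
  · rw [hbump N haN, hkN']

theorem sum_rowInsert (hf : IsGT N f) (ha : a < N) (t : ℕ) :
    ∑ i ∈ Finset.range N, _root_.rowInsert f a i t =
      ∑ i ∈ Finset.range N, f i t + if a < t then 1 else 0 := by
  simp only [_root_.rowInsert, Finset.sum_add_distrib]
  congr 1
  by_cases h : a < t
  · simp [h, hf.bumpRow_lt ha t]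
  · simp [h]

end IsGT

/-! ### Breaks in sequences of colored letters -/

/-- Whether a letter starts a new part, given its predecessor (if any): it does unless the
predecessor is related to it by `R`. -/
def startsPart {α : Type*} (R : α → α → Bool) : Option α → α → Bool
  | none, _ => true
  | some y, x => !R y x

/-- The list of the colors of the letters of a word, together with the marks telling which letters
start a new part; `p` is the letter that precedes the word. -/
def partStarts {r : ℕ} {β : Type*} (R : Fin r × β → Fin r × β → Bool) :
    Option (Fin r × β) → List (Fin r × β) → List (Fin r × Bool)
  | _, [] => []
  | p, x :: v => (x.1, startsPart R p x) :: partStarts R (some x) v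

/-- `y` and `x` can be adjacent letters of the same part of a word. -/
def letterRel {r : ℕ} (y x : Fin r × ℕ) : Bool := decide (y.1 = x.1 ∧ y.2 ≤ x.2)

/-- The cells containing `i` and `i + 1`, given by colors and rows, do not form a descent. -/
def cellRel {r : ℕ} (y x : Fin r × ℕ) : Bool := decide (y.1 = x.1 ∧ x.2 ≤ y.2)

section PartStarts

variable {r : ℕ} {β : Type*} (R : Fin r × β → Fin r × β → Bool)

theorem partStarts_append (p : Option (Fin r × β)) (u v : List (Fin r × β)) :
    partStarts R p (u ++ v) = partStarts R p u ++ partStarts R (u.getLast?.or p) v := by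
  induction u generalizing p with
  | nil => simp [partStarts]
  | cons x u ih =>
    simp only [List.cons_append, partStarts, ih, List.getLast?_cons]
    congr 2
    cases u.getLast? <;> simp

@[simp] theorem length_partStarts (p : Option (Fin r × β)) (v : List (Fin r × β)) :
    (partStarts R p v).length = v.length := by
  induction v generalizing p with
  | nil => rfl
  | cons x v ih => simp [partStarts, ih]

theorem map_fst_partStarts (p : Option (Fin r × β)) (v : List (Fin r × β)) :
    (partStarts R p v).map Prod.fst = v.map Prod.fst := by
  induction v generalizing p with
  | nil => rfl
  | cons x v ih => simp [partStarts, ih]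

end PartStarts

/-- In the reversed word of the cells added one after the other to an `r`-partite partition, every
suffix describes an `r`-partite partition. -/
def IsLattice {r : ℕ} (κ : List (Fin r × ℕ)) : Prop :=
  ∀ s, s <:+ κ → ∀ j i, s.count (j, i + 1) ≤ s.count (j, i)

theorem isLattice_nil {r : ℕ} : IsLattice ([] : List (Fin r × ℕ)) := by
  intro s hs j i
  simp [List.suffix_nil.1 hs]

theorem isLattice_cons {r : ℕ} {x : Fin r × ℕ} {κ : List (Fin r × ℕ)} :
    IsLattice (x :: κ) ↔
      (∀ j i, (x :: κ).count (j, i + 1) ≤ (x :: κ).count (j, i)) ∧ IsLattice κ := by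
  simp only [IsLattice, List.suffix_cons_iff]
  constructor
  · exact fun h => ⟨h _ (Or.inl rfl), fun s hs => h s (Or.inr hs)⟩
  · rintro ⟨h1, h2⟩ s (rfl | hs)
    · exact h1
    · exact h2 s hs

/-! ### The Robinson–Schensted–Knuth correspondence for colored words -/

section RSK

variable {r N : ℕ}

/-- Insertion of a colored letter into an `r`-partite tableau. -/
def colorInsert (F : Fin r → ℕ → ℕ → ℕ) (x : Fin r × ℕ) : Fin r → ℕ → ℕ → ℕ :=
  Function.update F x.1 (rowInsert (F x.1) x.2)

/-- The insertion tableau of a colored word (read from right to left). -/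
def rskP : List (Fin r × ℕ) → Fin r → ℕ → ℕ → ℕ
  | [] => 0
  | x :: w => colorInsert (rskP w) x

/-- The recording tableau of a colored word (read from right to left), as the word of the colors and
rows of the successively added cells. -/
def rskQ (N : ℕ) : List (Fin r × ℕ) → List (Fin r × ℕ)
  | [] => []
  | x :: w => (x.1, bumpRow (rskP w x.1) x.2 N) :: rskQ N w

@[simp] theorem length_rskQ (w : List (Fin r × ℕ)) : (rskQ N w).length = w.length := by
  induction w with
  | nil => rfl
  | cons x w ih => simp [rskQ, ih]

theorem isGT_zero : IsGT N 0 := ⟨by simp, by simp, by simp, by simp⟩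

theorem isGT_colorInsert {F : Fin r → ℕ → ℕ → ℕ} {x : Fin r × ℕ} (hF : ∀ j, IsGT N (F j))
    (hx : x.2 < N) (j : Fin r) : IsGT N (colorInsert F x j) := by
  unfold colorInsert
  rcases eq_or_ne j x.1 with rfl | h
  · simpa using (hF x.1).rowInsert hx
  · simpa [h] using hF j

theorem isGT_rskP {w : List (Fin r × ℕ)} (hw : ∀ x ∈ w, x.2 < N) (j : Fin r) :
    IsGT N (rskP w j) := by
  induction w generalizing j with
  | nil => exact isGT_zero
  | cons x w ih =>
    exact isGT_colorInsert (ih fun y hy => hw y (by simp [hy])) (hw x (by simp)) j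

theorem count_rskQ {w : List (Fin r × ℕ)} (hw : ∀ x ∈ w, x.2 < N) (j : Fin r) (i : ℕ) :
    (rskQ N w).count (j, i) = rskP w j i N := by
  induction w generalizing j with
  | nil => rfl
  | cons x w ih =>
    have hx := hw x (by simp)
    rw [rskQ, List.count_cons, ih fun y hy => hw y (by simp [hy])]
    simp only [rskP, colorInsert]
    rcases eq_or_ne j x.1 with rfl | h
    · simp [rowInsert, hx]
    · simp [h, h.symm]

theorem sum_rskP {w : List (Fin r × ℕ)} (hw : ∀ x ∈ w, x.2 < N) (j : Fin r) (t : ℕ) :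
    ∑ i ∈ Finset.range N, rskP w j i t = w.countP fun x => x.1 = j ∧ x.2 < t := by
  induction w with
  | nil => simp [rskP]
  | cons x w ih =>
    have hw' : ∀ y ∈ w, y.2 < N := fun y hy => hw y (by simp [hy])
    have hx := hw x (by simp)
    rw [List.countP_cons, ← ih hw']
    simp only [rskP, colorInsert]
    rcases eq_or_ne j x.1 with rfl | h
    · simp [(isGT_rskP hw' x.1).sum_rowInsert hx]
    · simp [h, h.symm]

theorem isLattice_rskQ {w : List (Fin r × ℕ)} (hw : ∀ x ∈ w, x.2 < N) :
    IsLattice (rskQ N w) := by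
  induction w with
  | nil => exact isLattice_nil
  | cons x w ih =>
    refine isLattice_cons.2 ⟨fun j i => ?_, ih fun y hy => hw y (by simp [hy])⟩
    have h1 := count_rskQ hw j i
    have h2 := count_rskQ hw j (i + 1)
    rw [rskQ] at h1 h2
    rw [h1, h2]
    exact (isGT_rskP hw j).antitone_row i N

/-- The recording tableau has the same colored descents as the word. -/
theorem partStarts_rskQ {w : List (Fin r × ℕ)} (hw : ∀ x ∈ w, x.2 < N) :
    partStarts cellRel none (rskQ N w).reverse = partStarts letterRel none w.reverse := by
  induction w with
  | nil => rfl
  | cons x w ih =>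
    have hw' : ∀ y ∈ w, y.2 < N := fun y hy => hw y (by simp [hy])
    rw [rskQ, List.reverse_cons, List.reverse_cons, partStarts_append, partStarts_append, ih hw']
    congr 1
    rcases w with _ | ⟨y, w⟩
    · rfl
    · have hw'' : ∀ z ∈ w, z.2 < N := fun z hz => hw' z (by simp [hz])
      simp only [rskQ, List.reverse_cons, List.getLast?_append, List.getLast?_singleton,
        Option.some_or, partStarts, startsPart, letterRel, cellRel, rskP,
        colorInsert]
      congr 3
      rcases eq_or_ne y.1 x.1 with h | h
      · rw [← h, Function.update_self]
        simpa using (isGT_rskP hw'' y.1).bumpRow_le_iff (hw' y (by simp)) (hw x (by simp))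
      · simp [h]

theorem rsk_injective {w w' : List (Fin r × ℕ)} (hw : ∀ x ∈ w, x.2 < N)
    (hw' : ∀ x ∈ w', x.2 < N) (hP : rskP w = rskP w') (hQ : rskQ N w = rskQ N w') : w = w' := by
  induction w generalizing w' with
  | nil =>
    have := congrArg List.length hQ
    rw [length_rskQ, length_rskQ] at this
    exact (List.length_eq_zero_iff.1 this.symm).symm
  | cons x w ih =>
    rcases w' with _ | ⟨x', w'⟩
    · simp [rskQ] at hQ
    have h1 : ∀ y ∈ w, y.2 < N := fun y hy => hw y (by simp [hy])
    have h1' : ∀ y ∈ w', y.2 < N := fun y hy => hw' y (by simp [hy])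
    obtain ⟨c, a⟩ := x
    obtain ⟨c', a'⟩ := x'
    simp only [rskQ, List.cons.injEq, Prod.mk.injEq] at hQ
    obtain ⟨⟨rfl, hk⟩, hQ⟩ := hQ
    have hc := congrFun hP c
    simp only [rskP, colorInsert, Function.update_self] at hc
    obtain ⟨hf, rfl⟩ := (isGT_rskP h1 c).rowInsert_inj (isGT_rskP h1' c)
      (hw (c, a) (by simp)) (hw' (c, a') (by simp)) hc hk
    have hP' : rskP w = rskP w' := by
      funext j
      rcases eq_or_ne j c with rfl | h
      · exact hf
      · simpa [rskP, colorInsert, h] using congrFun hP j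
    rw [ih h1 h1' hP' hQ]

theorem rsk_surjective {κ : List (Fin r × ℕ)} (hκ : IsLattice κ) {F : Fin r → ℕ → ℕ → ℕ}
    (hF : ∀ j, IsGT N (F j)) (h : ∀ j i, F j i N = κ.count (j, i)) :
    ∃ w : List (Fin r × ℕ), (∀ x ∈ w, x.2 < N) ∧ rskP w = F ∧ rskQ N w = κ := by
  induction κ generalizing F with
  | nil =>
    refine ⟨[], by simp, ?_, rfl⟩
    funext j i t
    have h1 := h j i
    have h2 : F j i t ≤ F j i (max t N) := (hF j).mono_le i (le_max_left _ _)
    rw [(hF j).eq_of_le i (le_max_right _ _), h1] at h2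
    simpa [rskP, eq_comm] using h2
  | cons k κ ih =>
    obtain ⟨c, K⟩ := k
    obtain ⟨h1, hκ⟩ := isLattice_cons.1 hκ
    have hK : F c (K + 1) N < F c K N := by
      have := hκ κ List.suffix_rfl c K
      rw [h, h]
      simp
      omega
    obtain ⟨g, a, hg, ha, hgF, hgK⟩ := (hF c).exists_rowInsert hK
    obtain ⟨w, hw, hP, hQ⟩ := ih hκ (F := Function.update F c g)
      (by
        intro j
        rcases eq_or_ne j c with rfl | hj
        · simpa using hg
        · simpa [hj] using hF j)
      (by
        intro j i
        have h3 := h j i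
        rw [List.count_cons] at h3
        rcases eq_or_ne j c with rfl | hj
        · rw [← hgF, rowInsert] at h3
          simp only [ha, hgK, true_and] at h3
          simp only [Function.update_self]
          simp at h3
          omega
        · rw [Function.update_of_ne hj, h3]
          simp [hj.symm])
    refine ⟨(c, a) :: w, ?_, ?_, ?_⟩
    · intro x hx
      rcases List.mem_cons.1 hx with rfl | hx
      · exact ha
      · exact hw x hx
    · simp [rskP, colorInsert, hP, hgF]
    · simp [rskQ, hP, hQ, hgK]

end RSK

/-! ### Colored compositions as sequences of marked colors -/

/-- The sequence of the colors of the positions of a colored composition, with marks telling which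
positions start a part. -/
def expandParts {r : ℕ} (l : List (ℕ × Fin r)) : List (Fin r × Bool) :=
  l.flatMap fun p => (p.2, true) :: List.replicate (p.1 - 1) (p.2, false)

/-- The partial sums of a colored composition. -/
def partEnds {r : ℕ} : List (ℕ × Fin r) → List ℕ
  | [] => []
  | p :: l => p.1 :: (partEnds l).map (p.1 + ·)

section Expand

variable {r : ℕ}

@[simp] theorem expandParts_nil : expandParts ([] : List (ℕ × Fin r)) = [] := rfl

theorem expandParts_cons (p : ℕ × Fin r) (l : List (ℕ × Fin r)) :
    expandParts (p :: l) =
      (p.2, true) :: (List.replicate (p.1 - 1) (p.2, false) ++ expandParts l) := by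
  simp [expandParts]

theorem expandParts_append (l l' : List (ℕ × Fin r)) :
    expandParts (l ++ l') = expandParts l ++ expandParts l' := by
  simp [expandParts]

theorem length_expandParts {l : List (ℕ × Fin r)} (hl : ∀ p ∈ l, 0 < p.1) :
    (expandParts l).length = (l.map Prod.fst).sum := by
  induction l with
  | nil => rfl
  | cons p l ih =>
    have := hl p (by simp)
    rw [expandParts_cons, List.map_cons, List.sum_cons, ← ih fun q hq => hl q (by simp [hq])]
    simp
    omega

theorem getElem?_expandParts_cons {p : ℕ × Fin r} (hp : 0 < p.1) (l : List (ℕ × Fin r)) (i : ℕ) :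
    (expandParts (p :: l))[i]? =
      if i < p.1 then some (p.2, decide (i = 0)) else (expandParts l)[i - p.1]? := by
  rw [expandParts_cons]
  rcases i with _ | i
  · simp [hp]
  · rw [List.getElem?_cons_succ, List.getElem?_append]
    simp only [List.length_replicate]
    split_ifs with h1 h2 h2
    · simp [h1]
    · omega
    · omega
    · congr 1; omega

theorem pos_of_mem_partEnds {l : List (ℕ × Fin r)} (hl : ∀ p ∈ l, 0 < p.1) {i : ℕ}
    (hi : i ∈ partEnds l) : 0 < i := by
  cases l with
  | nil => simp [partEnds] at hi
  | cons p l =>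
    have := hl p (by simp)
    simp only [partEnds, List.mem_cons, List.mem_map] at hi
    omega

theorem sortedLT_partEnds {l : List (ℕ × Fin r)} (hl : ∀ p ∈ l, 0 < p.1) :
    (partEnds l).Pairwise (· < ·) := by
  induction l with
  | nil => simp [partEnds]
  | cons p l ih =>
    have hl' : ∀ q ∈ l, 0 < q.1 := fun q hq => hl q (by simp [hq])
    simp only [partEnds, List.pairwise_cons, List.mem_map]
    refine ⟨?_, ?_⟩
    · rintro _ ⟨i, hi, rfl⟩
      have := pos_of_mem_partEnds hl' hi
      omega
    · rw [List.pairwise_map]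
      exact (ih hl').imp (by intros; omega)

theorem mem_partEnds {l : List (ℕ × Fin r)} (hl : ∀ p ∈ l, 0 < p.1) {i : ℕ} :
    i ∈ partEnds l ↔ 0 < i ∧ i ≤ (l.map Prod.fst).sum ∧
      (i = (l.map Prod.fst).sum ∨ ∃ c, (expandParts l)[i]? = some (c, true)) := by
  induction l generalizing i with
  | nil => simp [partEnds]; omega
  | cons p l ih =>
    have hl' : ∀ q ∈ l, 0 < q.1 := fun q hq => hl q (by simp [hq])
    have hp := hl p (by simp)
    have hlen := length_expandParts hl'
    simp only [partEnds, List.mem_cons, List.mem_map, ih hl', List.map_cons, List.sum_cons,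
      getElem?_expandParts_cons hp]
    constructor
    · rintro (rfl | ⟨i, ⟨h1, h2, h3⟩, rfl⟩)
      · refine ⟨hp, by omega, ?_⟩
        rcases l with _ | ⟨q, l⟩
        · simp
        · right
          have := getElem?_expandParts_cons (hl' q (by simp)) l 0
          simp only [lt_irrefl, if_false, Nat.sub_self, this, hl' q (by simp), if_true]
          exact ⟨q.2, rfl⟩
      · refine ⟨by omega, by omega, ?_⟩
        rcases h3 with h3 | ⟨c, h3⟩
        · left; omega
        · right
          refine ⟨c, ?_⟩
          rw [if_neg (by omega), Nat.add_sub_cancel_left, h3]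
    · rintro ⟨h1, h2, h3⟩
      rcases lt_trichotomy i p.1 with h | h | h
      · rcases h3 with h3 | ⟨c, h3⟩
        · omega
        · rw [if_pos h] at h3
          simp at h3
          omega
      · exact Or.inl h
      · refine Or.inr ⟨i - p.1, ⟨by omega, by omega, ?_⟩, by omega⟩
        rcases h3 with h3 | ⟨c, h3⟩
        · left; omega
        · rw [if_neg (by omega)] at h3
          exact Or.inr ⟨c, h3⟩

/-- A colored composition is recovered from its partial sums and the colors at these positions. -/
theorem map_range_partEnds {l : List (ℕ × Fin r)} (hl : ∀ p ∈ l, 0 < p.1) (col : ℕ → Fin r)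
    (hcol : ∀ i x, (expandParts l)[i]? = some x → col (i + 1) = x.1) :
    ((List.range (partEnds l).length).map fun k =>
      ((partEnds l).getD k 0 - (if k = 0 then 0 else (partEnds l).getD (k - 1) 0),
        col ((partEnds l).getD k 0))) = l := by
  induction l generalizing col with
  | nil => rfl
  | cons p l ih =>
    have hl' : ∀ q ∈ l, 0 < q.1 := fun q hq => hl q (by simp [hq])
    have hp := hl p (by simp)
    have h1 := ih hl' (fun i => col (p.1 + i)) (by
      intro i x hx
      refine hcol (p.1 + i) x ?_
      rw [getElem?_expandParts_cons hp, if_neg (by omega), Nat.add_sub_cancel_left, hx])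
    have h0 : col p.1 = p.2 := by
      have := hcol (p.1 - 1) (p.2, decide (p.1 - 1 = 0)) (by
        rw [getElem?_expandParts_cons hp, if_pos (by omega)])
      rwa [Nat.sub_add_cancel hp] at this
    simp only [partEnds, List.length_cons, List.length_map, List.range_succ_eq_map, List.map_cons,
      List.map_map]
    congr 1
    · simp [h0]
    · conv_rhs => rw [← h1]
      refine List.map_congr_left fun k hk => ?_
      rw [List.mem_range] at hk
      have e : ∀ k < (partEnds l).length,
          ((partEnds l).map (p.1 + ·)).getD k 0 = p.1 + (partEnds l).getD k 0 := by
        intro k hk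
        simp [List.getD_eq_getElem?_getD, hk]
      simp only [Function.comp, Nat.succ_eq_add_one, List.getD_cons_succ, e k hk]
      rcases k with _ | k
      · simp
      · have h2 : k < (partEnds l).length := by omega
        simp only [Nat.add_sub_cancel, List.getD_cons_succ, e k h2, Nat.add_eq_zero_iff,
          one_ne_zero, and_false, if_false]
        congr 1
        omega

/-- Every sequence of marked colors whose parts are monochromatic comes from a colored
composition. -/
theorem exists_expandParts_eq {β : Type*} (R : Fin r × β → Fin r × β → Bool)
    (hR : ∀ x y, R x y = true → x.1 = y.1) (v : List (Fin r × β)) :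
    ∃ l : List (ℕ × Fin r), (∀ p ∈ l, 0 < p.1) ∧ expandParts l = partStarts R none v := by
  have key : ∀ (v : List (Fin r × β)) (x : Fin r × β), ∃ (a : ℕ) (l : List (ℕ × Fin r)),
      (∀ p ∈ l, 0 < p.1) ∧
        List.replicate a (x.1, false) ++ expandParts l = partStarts R (some x) v := by
    intro v
    induction v with
    | nil => exact fun x => ⟨0, [], by simp, rfl⟩
    | cons y v ih =>
      intro x
      obtain ⟨a, l, hl, h⟩ := ih y
      cases hxy : R x y with
      | true =>
        refine ⟨a + 1, l, hl, ?_⟩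
        simp [partStarts, startsPart, hxy, ← h, hR x y hxy, List.replicate_succ]
      | false =>
        refine ⟨0, (a + 1, y.1) :: l, ?_, ?_⟩
        · intro p hp
          rcases List.mem_cons.1 hp with rfl | hp
          · simp
          · exact hl p hp
        · simp [partStarts, startsPart, hxy, ← h, expandParts_cons]
  rcases v with _ | ⟨x, v⟩
  · exact ⟨[], by simp, rfl⟩
  · obtain ⟨a, l, hl, h⟩ := key v x
    refine ⟨(a + 1, x.1) :: l, ?_, ?_⟩
    · intro p hp
      rcases List.mem_cons.1 hp with rfl | hp
      · simp
      · exact hl p hp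
    · simp [partStarts, startsPart, ← h, expandParts_cons]

theorem getElem?_partStarts {β : Type*} (R : Fin r × β → Fin r × β → Bool)
    (p : Option (Fin r × β)) (v : List (Fin r × β)) (i : ℕ) :
    (partStarts R p v)[i]? =
      v[i]?.map fun x => (x.1, startsPart R (if i = 0 then p else v[i - 1]?) x) := by
  induction v generalizing p i with
  | nil => simp [partStarts]
  | cons x v ih =>
    rcases i with _ | i
    · simp [partStarts]
    · simp only [partStarts, List.getElem?_cons_succ, ih]
      rcases i with _ | i <;> simp

end Expand

/-! ### Standard Young `r`-partite tableaux as lattice words -/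

section SYT

variable {r n : ℕ} {lam : Fin r → YoungDiagram} {T : Fin r → ℤ × ℤ → ℕ} {v : List (Fin r × ℕ)}

theorem mem_shOf {j : Fin r} {z : ℤ × ℤ} :
    z ∈ shOf lam j ↔ ∃ i c : ℕ, c < (lam j).rowLen i ∧ z = ((i : ℤ), (c : ℤ)) := by
  simp only [shOf, Finset.mem_image, YoungDiagram.mem_cells, Prod.exists,
    YoungDiagram.mem_iff_lt_rowLen, eq_comm]

@[simp] theorem coe_mem_shOf {j : Fin r} {i c : ℕ} :
    ((i : ℤ), (c : ℤ)) ∈ shOf lam j ↔ c < (lam j).rowLen i := by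
  rw [mem_shOf]
  constructor
  · rintro ⟨i', c', h, e⟩
    simp only [Prod.mk.injEq, Nat.cast_inj] at e
    rwa [e.1, e.2]
  · exact fun h => ⟨i, c, h, rfl⟩

/-- `v` lists the colors and rows of the cells of `T` in the order of their entries. -/
def IsRowWord (lam : Fin r → YoungDiagram) (n : ℕ) (T : Fin r → ℤ × ℤ → ℕ)
    (v : List (Fin r × ℕ)) : Prop :=
  v.length = n ∧ ∀ j (i c : ℕ), c < (lam j).rowLen i →
    0 < T j (i, c) ∧ v[T j (i, c) - 1]? = some (j, i)

theorem IsPartiteSYT.exists_isRowWord (hT : IsPartiteSYT (shOf lam) n T) :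
    ∃ v, IsRowWord lam n T v := by
  obtain ⟨-, h2, h3, -, -⟩ := hT
  have h3' : ∀ m : Fin n, ∃! p : Fin r × (ℤ × ℤ), p.2 ∈ shOf lam p.1 ∧ T p.1 p.2 = m + 1 :=
    fun m => h3 _ (by simp)
  choose p hp hp' using h3'
  refine ⟨List.ofFn fun m => ((p m).1, (p m).2.1.toNat), by simp, fun j i c hc => ?_⟩
  have h := h2 j (i, c) (coe_mem_shOf.2 hc)
  rw [Finset.mem_Icc] at h
  refine ⟨h.1, ?_⟩
  have e := hp' ⟨T j (i, c) - 1, by omega⟩ (j, (i, c))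
    ⟨coe_mem_shOf.2 hc, by simp only; omega⟩
  rw [List.getElem?_ofFn, dif_pos (by omega), ← e]
  simp

theorem IsPartiteSYT.row_lt (hT : IsPartiteSYT (shOf lam) n T) {j : Fin r} {i c c' : ℕ}
    (hcc : c < c') (hc : c' < (lam j).rowLen i) : T j (i, c) < T j (i, c') := by
  induction c', hcc using Nat.le_induction with
  | base => exact hT.2.2.2.1 j (i, c) (coe_mem_shOf.2 (by omega)) (coe_mem_shOf.2 hc)
  | succ c' hcc ih =>
    exact (ih (by omega)).trans
      (hT.2.2.2.1 j (i, c') (coe_mem_shOf.2 (by omega)) (coe_mem_shOf.2 hc))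

theorem IsPartiteSYT.col_lt (hT : IsPartiteSYT (shOf lam) n T) {j : Fin r} {i c : ℕ}
    (hc : c < (lam j).rowLen (i + 1)) : T j (i, c) < T j ((i + 1 : ℕ), c) := by
  have h : c < (lam j).rowLen i := hc.trans_le ((lam j).rowLen_anti i (i + 1) (by omega))
  have := hT.2.2.2.2 j (i, c) (coe_mem_shOf.2 h)
  push_cast at this ⊢
  exact this (by exact_mod_cast coe_mem_shOf.2 hc)

theorem IsRowWord.getElem?_eq_some_iff (hT : IsPartiteSYT (shOf lam) n T)
    (hv : IsRowWord lam n T v) {j : Fin r} {i m : ℕ} :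
    v[m]? = some (j, i) ↔ ∃ c < (lam j).rowLen i, T j (i, c) = m + 1 := by
  constructor
  · intro h
    have hm : m < n := by
      rw [← hv.1]; exact (List.getElem?_eq_some_iff.1 h).1
    obtain ⟨⟨j', z⟩, ⟨hz, hTz⟩, -⟩ := hT.2.2.1 (m + 1) (by simpa using hm)
    obtain ⟨i', c, hc, rfl⟩ := mem_shOf.1 hz
    have := (hv.2 j' i' c hc).2
    simp only at hTz
    rw [hTz, Nat.add_sub_cancel, h] at this
    simp only [Option.some.injEq, Prod.mk.injEq] at this
    obtain ⟨rfl, rfl⟩ := this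
    exact ⟨c, hc, hTz⟩
  · rintro ⟨c, hc, h⟩
    have := (hv.2 j i c hc).2
    rwa [h, Nat.add_sub_cancel] at this

theorem IsRowWord.count_eq (hT : IsPartiteSYT (shOf lam) n T) (hv : IsRowWord lam n T v)
    (j : Fin r) (i M : ℕ) :
    Nat.count (fun m => v[m]? = some (j, i)) M =
      ((Finset.range ((lam j).rowLen i)).filter fun c : ℕ => T j (i, c) ≤ M).card := by
  rw [Nat.count_eq_card_filter_range]
  symm
  refine Finset.card_bij (fun c _ => T j (i, c) - 1) ?_ ?_ ?_
  · intro c hc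
    simp only [Finset.mem_filter, Finset.mem_range] at hc ⊢
    have := hv.2 j i c hc.1
    exact ⟨by omega, this.2⟩
  · intro c hc c' hc' h
    simp only [Finset.mem_filter, Finset.mem_range] at hc hc'
    have h1 := (hv.2 j i c hc.1).1
    have h2 := (hv.2 j i c' hc'.1).1
    rcases lt_trichotomy c c' with h3 | h3 | h3
    · have := hT.row_lt h3 hc'.1; omega
    · exact h3
    · have := hT.row_lt h3 hc.1; omega
  · intro m hm
    simp only [Finset.mem_filter, Finset.mem_range] at hm
    obtain ⟨c, hc, h⟩ := (hv.getElem?_eq_some_iff hT).1 hm.2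
    refine ⟨c, ?_, by omega⟩
    simp only [Finset.mem_filter, Finset.mem_range]
    exact ⟨hc, by omega⟩

theorem IsRowWord.eq_nth (hT : IsPartiteSYT (shOf lam) n T) (hv : IsRowWord lam n T v)
    {j : Fin r} {i c : ℕ} (hc : c < (lam j).rowLen i) :
    T j (i, c) = Nat.nth (fun m => v[m]? = some (j, i)) c + 1 := by
  have h := hv.2 j i c hc
  have h1 := hv.count_eq hT j i (T j (i, c) - 1)
  have h2 : ((Finset.range ((lam j).rowLen i)).filter
      fun c' : ℕ => T j (i, c') ≤ T j (i, c) - 1) = Finset.range c := by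
    ext c'
    simp only [Finset.mem_filter, Finset.mem_range]
    constructor
    · rintro ⟨h3, h4⟩
      by_contra h5
      rcases (by omega : c = c' ∨ c < c') with rfl | h6
      · omega
      · have := hT.row_lt h6 h3; omega
    · intro h3
      have := hT.row_lt h3 hc
      exact ⟨by omega, by omega⟩
  rw [h2, Finset.card_range] at h1
  have h3 := Nat.nth_count (p := fun m => v[m]? = some (j, i)) (n := T j (i, c) - 1) h.2
  rw [h1] at h3
  omega

theorem count_take_eq (v : List (Fin r × ℕ)) (x : Fin r × ℕ) (M : ℕ) :
    (v.take M).count x = Nat.count (fun m => v[m]? = some x) M := by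
  induction M with
  | zero => simp
  | succ M ih =>
    rw [List.take_add_one, List.count_append, ih, Nat.count_succ]
    rcases h : v[M]? with _ | y
    · simp
    · simp [List.count_cons]

theorem isLattice_reverse_iff :
    IsLattice v.reverse ↔ ∀ M j i,
      Nat.count (fun m => v[m]? = some (j, i + 1)) M ≤
        Nat.count (fun m => v[m]? = some (j, i)) M := by
  simp only [← count_take_eq]
  constructor
  · intro h M j i
    have := h (v.take M).reverse (List.reverse_suffix.2 (List.take_prefix _ _)) j i
    simpa using this
  · intro h s hs j i
    have h1 : s.reverse <+: v := by simpa using List.reverse_prefix.2 hs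
    rw [List.prefix_iff_eq_take] at h1
    have h2 := h s.reverse.length j i
    rw [← h1] at h2
    simpa using h2

theorem count_eq_count_length (v : List (Fin r × ℕ)) (x : Fin r × ℕ) :
    v.count x = Nat.count (fun m => v[m]? = some x) v.length := by
  rw [← count_take_eq, List.take_length]

theorem IsRowWord.count_eq_rowLen (hT : IsPartiteSYT (shOf lam) n T) (hv : IsRowWord lam n T v)
    (j : Fin r) (i : ℕ) : v.count (j, i) = (lam j).rowLen i := by
  rw [count_eq_count_length, hv.count_eq hT, Finset.filter_true_of_mem, Finset.card_range]
  intro c hc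
  have := hT.2.1 j (i, c) (coe_mem_shOf.2 (Finset.mem_range.1 hc))
  rw [hv.1]
  exact (Finset.mem_Icc.1 this).2

theorem IsRowWord.isLattice (hT : IsPartiteSYT (shOf lam) n T) (hv : IsRowWord lam n T v) :
    IsLattice v.reverse := by
  rw [isLattice_reverse_iff]
  intro M j i
  rw [hv.count_eq hT, hv.count_eq hT]
  refine Finset.card_le_card fun c hc => ?_
  simp only [Finset.mem_filter, Finset.mem_range] at hc ⊢
  have := hT.col_lt hc.1
  exact ⟨hc.1.trans_le ((lam j).rowLen_anti i (i + 1) (by omega)), by omega⟩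

theorem IsRowWord.inj (hT : IsPartiteSYT (shOf lam) n T) (hv : IsRowWord lam n T v)
    {T' : Fin r → ℤ × ℤ → ℕ} (hT' : IsPartiteSYT (shOf lam) n T') (hv' : IsRowWord lam n T' v) :
    T = T' := by
  funext j z
  by_cases hz : z ∈ shOf lam j
  · obtain ⟨i, c, hc, rfl⟩ := mem_shOf.1 hz
    rw [hv.eq_nth hT hc, hv'.eq_nth hT' hc]
  · rw [hT.1 j z hz, hT'.1 j z hz]

theorem exists_isPartiteSYT (hv : IsLattice v.reverse) (hn : v.length = n)
    (hc : ∀ j i, v.count (j, i) = (lam j).rowLen i) :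
    ∃ T, IsPartiteSYT (shOf lam) n T ∧ IsRowWord lam n T v := by
  rw [isLattice_reverse_iff] at hv
  have hlt : ∀ {m x}, v[m]? = some x → m < n := by
    intro m x h
    rw [← hn]; exact (List.getElem?_eq_some_iff.1 h).1
  obtain ⟨T, hT⟩ : ∃ T : Fin r → ℤ × ℤ → ℕ, ∀ j z, T j z =
      if z ∈ shOf lam j then
        Nat.nth (fun m => v[m]? = some (j, z.1.toNat)) z.2.toNat + 1 else 0 := ⟨_, fun _ _ => rfl⟩
  have hT' : ∀ {j} {i c : ℕ}, c < (lam j).rowLen i →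
      T j (i, c) = Nat.nth (fun m => v[m]? = some (j, i)) c + 1 := by
    intro j i c h
    rw [hT, if_pos (coe_mem_shOf.2 h)]
    simp
  have hfin : ∀ {j : Fin r} {i c : ℕ}, c < (lam j).rowLen i →
      ∀ hf : {m : ℕ | v[m]? = some (j, i)}.Finite, c < hf.toFinset.card := by
    intro j i c h hf
    rw [← hc, count_eq_count_length, Nat.count_eq_card_filter_range] at h
    refine h.trans_le (Finset.card_le_card fun m hm => ?_)
    simpa using (Finset.mem_filter.1 hm).2
  have hmem : ∀ {j : Fin r} {i c : ℕ}, c < (lam j).rowLen i →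
      v[Nat.nth (fun m => v[m]? = some (j, i)) c]? = some (j, i) := fun h =>
    Nat.nth_mem (p := fun m => v[m]? = some (_, _)) _ (hfin h)
  have hrow : IsRowWord lam n T v := by
    refine ⟨hn, fun j i c h => ?_⟩
    rw [hT' h]
    exact ⟨by omega, hmem h⟩
  refine ⟨T, ⟨fun j z hz => by rw [hT, if_neg hz], ?_, ?_, ?_, ?_⟩, hrow⟩
  · intro j z hz
    obtain ⟨i, c, h, rfl⟩ := mem_shOf.1 hz
    have := hlt (hmem h)
    rw [hT' h, Finset.mem_Icc]
    omega
  · intro m hm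
    rw [Finset.mem_Icc] at hm
    obtain ⟨⟨j, i⟩, hx⟩ : ∃ x, v[m - 1]? = some x :=
      ⟨_, List.getElem?_eq_getElem (by omega)⟩
    have hcnt := Nat.nth_count (p := fun m => v[m]? = some (j, i)) hx
    have hclt : Nat.count (fun m => v[m]? = some (j, i)) (m - 1) < (lam j).rowLen i := by
      rw [← hc, count_eq_count_length]
      exact Nat.count_strict_mono hx (by omega)
    refine ⟨(j, (i, (Nat.count (fun m => v[m]? = some (j, i)) (m - 1) : ℕ))), ?_, ?_⟩
    · refine ⟨coe_mem_shOf.2 hclt, ?_⟩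
      simp only
      rw [hT' hclt, hcnt]
      omega
    · rintro ⟨j', z⟩ ⟨hz, hTz⟩
      obtain ⟨i', c', h, rfl⟩ := mem_shOf.1 hz
      simp only at hTz
      have h1 := (hrow.2 j' i' c' h).2
      rw [hTz, hx] at h1
      simp only [Option.some.injEq, Prod.mk.injEq] at h1
      obtain ⟨rfl, rfl⟩ := h1
      have h2 := Nat.count_nth (p := fun m => v[m]? = some (j, i)) (hfin h)
      rw [hT' h] at hTz
      simp only at hTz
      rw [show m - 1 = Nat.nth (fun m => v[m]? = some (j, i)) c' by omega, h2]
  · intro j z hz hz'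
    obtain ⟨i, c, h, rfl⟩ := mem_shOf.1 hz
    simp only at hz' ⊢
    have e : ((c : ℤ) + 1) = ((c + 1 : ℕ) : ℤ) := by push_cast; rfl
    rw [e] at hz' ⊢
    have h' := coe_mem_shOf.1 hz'
    rw [hT' h, hT' h']
    have := Nat.nth_lt_nth' (p := fun m => v[m]? = some (j, i)) (lt_add_one c) (hfin h')
    omega
  · intro j z hz hz'
    obtain ⟨i, c, h, rfl⟩ := mem_shOf.1 hz
    simp only at hz' ⊢
    have e : ((i : ℤ) + 1) = ((i + 1 : ℕ) : ℤ) := by push_cast; rfl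
    rw [e] at hz' ⊢
    have h' := coe_mem_shOf.1 hz'
    rw [hT' h, hT' h']
    have h1 := hmem h'
    have h2 := Nat.count_nth (p := fun m => v[m]? = some (j, i + 1)) (hfin h')
    have h3 := hv (Nat.nth (fun m => v[m]? = some (j, i + 1)) c + 1) j i
    rw [Nat.count_succ_eq_succ_count_iff.2 h1, h2] at h3
    have h4 := Nat.nth_lt_of_lt_count (p := fun m => v[m]? = some (j, i)) (k := c)
      (n := Nat.nth (fun m => v[m]? = some (j, i + 1)) c + 1) (by omega)
    have h5 : Nat.nth (fun m => v[m]? = some (j, i)) c ≠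
        Nat.nth (fun m => v[m]? = some (j, i + 1)) c := by
      intro h5
      have h6 := hmem h
      rw [h5, h1] at h6
      simp at h6
    omega

theorem IsRowWord.tabColor_eq [NeZero r] (hT : IsPartiteSYT (shOf lam) n T)
    (hv : IsRowWord lam n T v) {m : ℕ} {x : Fin r × ℕ} (hx : v[m]? = some x) :
    tabColor (shOf lam) T (m + 1) = x.1 := by
  obtain ⟨j, i⟩ := x
  obtain ⟨c, hc, hm⟩ := (hv.getElem?_eq_some_iff hT).1 hx
  have h : ∃ p : Fin r × (ℤ × ℤ), p.2 ∈ shOf lam p.1 ∧ T p.1 p.2 = m + 1 :=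
    ⟨(j, (i, c)), coe_mem_shOf.2 hc, hm⟩
  rw [tabColor, dif_pos h]
  have hspec := Classical.choose_spec h
  generalize Classical.choose h = p at hspec
  obtain ⟨j', z⟩ := p
  obtain ⟨i', c', hc', rfl⟩ := mem_shOf.1 hspec.1
  have h1 := (hv.getElem?_eq_some_iff hT).2 ⟨c', hc', hspec.2⟩
  rw [hx] at h1
  simp only [Option.some.injEq, Prod.mk.injEq] at h1
  exact h1.1.symm

theorem IsRowWord.mem_sDesPlusTab (hT : IsPartiteSYT (shOf lam) n T)
    (hv : IsRowWord lam n T v) {i : ℕ} :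
    i ∈ sDesPlusTab (shOf lam) n T ↔ 0 < i ∧ i ≤ n ∧
      (i = n ∨ ∃ c, (partStarts cellRel none v)[i]? = some (c, true)) := by
  simp only [sDesPlusTab, Finset.mem_filter, Finset.mem_Icc, Nat.succ_le_iff, and_assoc]
  refine and_congr_right fun hi => and_congr_right fun hin => or_congr_right ?_
  rw [getElem?_partStarts, if_neg (by omega)]
  constructor
  · rintro ⟨j, z, hz, j', z', hz', h1, h2, h3⟩
    obtain ⟨a, c, hc, rfl⟩ := mem_shOf.1 hz
    obtain ⟨a', c', hc', rfl⟩ := mem_shOf.1 hz'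
    have e1 := (hv.2 j a c hc).2
    have e2 := (hv.2 j' a' c' hc').2
    rw [h1] at e1
    rw [h2, Nat.add_sub_cancel] at e2
    refine ⟨j', ?_⟩
    simp only [e1, e2, Option.map_some, startsPart, cellRel, Option.some.injEq, Prod.mk.injEq,
      true_and, Bool.not_eq_true', decide_eq_false_iff_not]
    simp only [Nat.cast_lt] at h3
    rintro ⟨h4, h5⟩
    rcases h3 with h3 | h3
    · exact h3 h4
    · omega
  · rintro ⟨c, h⟩
    obtain ⟨⟨j', a'⟩, e2, h⟩ := Option.map_eq_some_iff.1 h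
    have hlt := (List.getElem?_eq_some_iff.1 e2).1
    obtain ⟨⟨j, a⟩, e1⟩ : ∃ x, v[i - 1]? = some x :=
      ⟨_, List.getElem?_eq_getElem (by omega)⟩
    obtain ⟨b, hb, hTb⟩ := (hv.getElem?_eq_some_iff hT).1 e1
    obtain ⟨b', hb', hTb'⟩ := (hv.getElem?_eq_some_iff hT).1 e2
    refine ⟨j, _, coe_mem_shOf.2 hb, j', _, coe_mem_shOf.2 hb', by omega, hTb', ?_⟩
    simp only [e1, startsPart, cellRel, Prod.mk.injEq, Bool.not_eq_true',
      decide_eq_false_iff_not] at h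
    simp only [Nat.cast_lt]
    by_cases hj : j = j'
    · right
      have := h.2
      push Not at this
      exact this hj
    · exact Or.inl hj

theorem IsRowWord.coTab_eq [NeZero r] (hT : IsPartiteSYT (shOf lam) n T)
    (hv : IsRowWord lam n T v) {l : List (ℕ × Fin r)} (hl : ∀ p ∈ l, 0 < p.1)
    (h : expandParts l = partStarts cellRel none v) : coTab (shOf lam) n T = l := by
  have hsum : (l.map Prod.fst).sum = n := by
    rw [← length_expandParts hl, h, length_partStarts, hv.1]
  have hS : (sDesPlusTab (shOf lam) n T).sort (· ≤ ·) = partEnds l := by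
    have h1 : sDesPlusTab (shOf lam) n T = (partEnds l).toFinset := by
      ext i
      rw [hv.mem_sDesPlusTab hT, List.mem_toFinset, mem_partEnds hl, hsum, h]
    rw [h1, List.toFinset_sort]
    · exact (sortedLT_partEnds hl).imp le_of_lt
    · exact (sortedLT_partEnds hl).imp ne_of_lt
  simp only [coTab, hS]
  refine map_range_partEnds hl _ fun i x hx => ?_
  rw [h, getElem?_partStarts] at hx
  obtain ⟨y, hy, rfl⟩ := Option.map_eq_some_iff.1 hx
  exact hv.tabColor_eq hT hy

theorem IsRowWord.coTab_eq_iff [NeZero r] (hT : IsPartiteSYT (shOf lam) n T)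
    (hv : IsRowWord lam n T v) {l : List (ℕ × Fin r)} (hl : ∀ p ∈ l, 0 < p.1) :
    coTab (shOf lam) n T = l ↔ partStarts cellRel none v = expandParts l := by
  refine ⟨?_, fun h => hv.coTab_eq hT hl h.symm⟩
  obtain ⟨l', hl', h'⟩ := exists_expandParts_eq cellRel
    (fun x y h => (by simpa [cellRel] using h : x.1 = y.1 ∧ _).1) v
  rw [hv.coTab_eq hT hl' h']
  rintro rfl
  exact h'.symm

/-- Standard Young `r`-partite tableaux with a given colored descent composition correspond to
lattice words. -/
theorem ncard_partiteSYT [NeZero r] {l : List (ℕ × Fin r)} (hl : ∀ p ∈ l, 0 < p.1)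
    (hsum : (l.map Prod.fst).sum = n) :
    {T | IsPartiteSYT (shOf lam) n T ∧ coTab (shOf lam) n T = l}.ncard =
      {κ : List (Fin r × ℕ) | IsLattice κ ∧ (∀ j i, κ.count (j, i) = (lam j).rowLen i) ∧
        partStarts cellRel none κ.reverse = expandParts l}.ncard := by
  choose! f hf using fun T (hT : IsPartiteSYT (shOf lam) n T) => hT.exists_isRowWord
  refine Set.ncard_congr (fun T _ => (f T).reverse) ?_ ?_ ?_
  · rintro T ⟨hT, hco⟩
    refine ⟨(hf T hT).isLattice hT, fun j i => ?_, ?_⟩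
    · rw [List.count_reverse, (hf T hT).count_eq_rowLen hT]
    · rw [List.reverse_reverse, ← (hf T hT).coTab_eq_iff hT hl, hco]
  · rintro T T' ⟨hT, -⟩ ⟨hT', -⟩ h
    have h' := List.reverse_injective h
    have h1 := hf T' hT'
    rw [← h'] at h1
    exact (hf T hT).inj hT hT' h1
  · rintro κ ⟨h1, h2, h3⟩
    have hn : κ.reverse.length = n := by
      rw [← length_partStarts cellRel none, h3, length_expandParts hl, hsum]
    obtain ⟨T, hT, hv⟩ := exists_isPartiteSYT (lam := lam) (v := κ.reverse) (by simpa using h1) hn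
      (by simpa using h2)
    have hfv : f T = κ.reverse := by
      refine List.ext_getElem? fun m => Option.ext fun ⟨j, i⟩ => ?_
      simp only [(hf T hT).getElem?_eq_some_iff hT, hv.getElem?_eq_some_iff hT]
    refine ⟨T, ⟨hT, (hv.coTab_eq_iff hT hl).2 h3⟩, ?_⟩
    simp only [hfv, List.reverse_reverse]

end SYT

/-! ### Generating functions of weighted sets -/

/-- `g` is the generating function of the set `S` with respect to the weight `wt`. -/
structure IsGenFun {α σ : Type*} (S : Set α) (wt : α → σ →₀ ℕ) (g : MvPowerSeries σ ℤ) : Prop where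
  finite : ∀ d, {a | a ∈ S ∧ wt a = d}.Finite
  coeff_eq : ∀ d, MvPowerSeries.coeff d g = ({a | a ∈ S ∧ wt a = d}.ncard : ℤ)

namespace IsGenFun

variable {α β σ : Type*} {S : Set α} {S' : Set β} {wt : α → σ →₀ ℕ} {wt' : β → σ →₀ ℕ}
  {g g' : MvPowerSeries σ ℤ}

theorem congr (h : IsGenFun S wt g) (f : α → β) (hf : Set.BijOn f S S')
    (hwt : ∀ a ∈ S, wt' (f a) = wt a) : IsGenFun S' wt' g := by
  have himg : ∀ d, {b | b ∈ S' ∧ wt' b = d} = f '' {a | a ∈ S ∧ wt a = d} := by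
    intro d
    ext b
    simp only [Set.mem_ofPred_eq, Set.mem_image]
    constructor
    · rintro ⟨hb, h1⟩
      obtain ⟨a, ha, rfl⟩ := hf.surjOn hb
      exact ⟨a, ⟨ha, by rw [← hwt a ha, h1]⟩, rfl⟩
    · rintro ⟨a, ⟨ha, h1⟩, rfl⟩
      exact ⟨hf.mapsTo ha, by rw [hwt a ha, h1]⟩
  refine ⟨fun d => ?_, fun d => ?_⟩
  · rw [himg]; exact (h.finite d).image f
  · rw [himg, h.coeff_eq, Set.InjOn.ncard_image]
    exact hf.injOn.mono fun a ha => ha.1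

theorem mul (h : IsGenFun S wt g) (h' : IsGenFun S' wt' g') :
    IsGenFun (S ×ˢ S') (fun p => wt p.1 + wt' p.2) (g * g') := by
  classical
  have key : ∀ d, {p : α × β | p ∈ S ×ˢ S' ∧ wt p.1 + wt' p.2 = d} =
      ((Finset.HasAntidiagonal.antidiagonal d).biUnion fun e =>
        (h.finite e.1).toFinset ×ˢ (h'.finite e.2).toFinset : Finset (α × β)) := by
    intro d
    ext p
    simp only [Set.mem_prod, Set.mem_ofPred_eq, Finset.coe_biUnion, Finset.mem_coe,
      Finset.HasAntidiagonal.mem_antidiagonal, Finset.coe_product, Set.Finite.coe_toFinset, Set.mem_iUnion,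
      exists_prop, Prod.exists]
    constructor
    · rintro ⟨⟨h1, h2⟩, h3⟩
      exact ⟨_, _, h3, ⟨h1, rfl⟩, ⟨h2, rfl⟩⟩
    · rintro ⟨_, _, h3, ⟨h1, rfl⟩, ⟨h2, rfl⟩⟩
      exact ⟨⟨h1, h2⟩, h3⟩
  refine ⟨fun d => ?_, fun d => ?_⟩
  · rw [key]; exact Finset.finite_toSet _
  · rw [key, Set.ncard_coe_finset, Finset.card_biUnion, MvPowerSeries.coeff_mul]
    · push_cast
      refine Finset.sum_congr rfl fun e _ => ?_
      rw [h.coeff_eq, h'.coeff_eq, Finset.card_product, Set.ncard_eq_toFinset_card _ (h.finite _),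
        Set.ncard_eq_toFinset_card _ (h'.finite _)]
      push_cast
      rfl
    · intro e _ e' _ hne
      rw [Function.onFun, Finset.disjoint_left]
      intro p hp hp'
      simp only [Finset.mem_product, Set.Finite.mem_toFinset, Set.mem_ofPred_eq] at hp hp'
      refine hne (Prod.ext ?_ ?_)
      · rw [← hp.1.2, hp'.1.2]
      · rw [← hp.2.2, hp'.2.2]

theorem one (a : α) (ha : wt a = 0) : IsGenFun {a} wt 1 := by
  classical
  have key : ∀ d, {b | b ∈ ({a} : Set α) ∧ wt b = d} = if d = 0 then {a} else ∅ := by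
    intro d
    ext b
    simp only [Set.mem_singleton_iff, Set.mem_ofPred_eq]
    split_ifs with h
    · simp only [Set.mem_singleton_iff, and_iff_left_iff_imp]
      rintro rfl
      rw [ha, h]
    · simp only [Set.mem_empty_iff_false, iff_false, not_and]
      rintro rfl
      rw [ha]
      exact fun h' => h h'.symm
  refine ⟨fun d => ?_, fun d => ?_⟩
  · rw [key]; split_ifs <;> simp
  · rw [key, MvPowerSeries.coeff_one]; split_ifs <;> simp

/-- The product of generating functions is the generating function of the product set. -/
theorem prod {ι : Type*} [Fintype ι] [Zero α] {S : ι → Set α} {wt : ι → α → σ →₀ ℕ}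
    {g : ι → MvPowerSeries σ ℤ} (h : ∀ i, IsGenFun (S i) (wt i) (g i)) :
    IsGenFun {T : ι → α | ∀ i, T i ∈ S i} (fun T => ∑ i, wt i (T i)) (∏ i, g i) := by
  classical
  have key : ∀ s : Finset ι, IsGenFun {T : ι → α | (∀ i ∈ s, T i ∈ S i) ∧ ∀ i ∉ s, T i = 0}
      (fun T => ∑ i ∈ s, wt i (T i)) (∏ i ∈ s, g i) := by
    intro s
    induction s using Finset.induction_on with
    | empty =>
      have := one (wt := fun T : ι → α => ∑ i ∈ (∅ : Finset ι), wt i (T i)) (0 : ι → α) (by simp)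
      convert this using 1
      · ext T
        simp [funext_iff]
      · simp
    | insert i s hi ih =>
      rw [Finset.prod_insert hi]
      refine ((h i).mul ih).congr (fun p => Function.update p.2 i p.1) ⟨?_, ?_, ?_⟩ ?_
      · rintro ⟨a, T⟩ ⟨ha, h1, h2⟩
        refine ⟨fun j hj => ?_, fun j hj => ?_⟩
        · rcases eq_or_ne j i with rfl | hji
          · simpa using ha
          · simpa [hji] using h1 j (by simpa [hji] using hj)
        · rw [Finset.mem_insert, not_or] at hj
          simpa [hj.1] using h2 j hj.2
      · rintro ⟨a, T⟩ ⟨-, -, h2⟩ ⟨a', T'⟩ ⟨-, -, h2'⟩ e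
        simp only at e h2 h2'
        refine Prod.ext ?_ (funext fun j => ?_)
        · simpa using congrFun e i
        · rcases eq_or_ne j i with rfl | hji
          · simp only [h2 j hi, h2' j hi]
          · simpa [hji] using congrFun e j
      · rintro T ⟨h1, h2⟩
        refine ⟨(T i, Function.update T i 0), ⟨h1 i (by simp), fun j hj => ?_, fun j hj => ?_⟩,
          by simp⟩
        · have hji : j ≠ i := fun e => hi (e ▸ hj)
          simpa [hji] using h1 j (by simp [hj])
        · rcases eq_or_ne j i with rfl | hji
          · simp
          · simpa [hji] using h2 j (by simp [hji, hj])
      · rintro ⟨a, T⟩ -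
        simp only [Finset.sum_insert hi, Function.update_self]
        congr 1
        refine Finset.sum_congr rfl fun j hj => ?_
        rw [Function.update_of_ne]
        exact fun e => hi (e ▸ hj)
  simpa using key Finset.univ

end IsGenFun

/-- The semistandard fillings of the cells in `D`. -/
def semistandardFillings (D : Finset (ℤ × ℤ)) : Set (ℤ × ℤ → ℕ) :=
  {T | (∀ c ∉ D, T c = 0) ∧
    (∀ c ∈ D, (c.1, c.2 + 1) ∈ D → T c ≤ T (c.1, c.2 + 1)) ∧
    (∀ c ∈ D, (c.1 + 1, c.2) ∈ D → T c < T (c.1 + 1, c.2))}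

theorem isGenFun_skewSchurIn {r : ℕ} (j : Fin r) (D : Finset (ℤ × ℤ)) :
    IsGenFun (semistandardFillings D) (fun T => ∑ c ∈ D, Finsupp.single (j, T c) 1)
      (skewSchurIn j D) := by
  constructor
  · intro d
    have hfin : {t : D → ℕ | ∀ c, t c ∈ {a | (j, a) ∈ d.support}}.Finite := by
      refine Set.Finite.pi' fun _ => ?_
      exact d.support.finite_toSet.preimage (f := fun a => (j, a))
        (fun a _ b _ h => (Prod.mk.inj h).2)
    refine Set.Finite.of_injOn (f := fun T c => T c.1) ?_ ?_ hfin
    · rintro T ⟨-, h⟩ c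
      simp only [Set.mem_ofPred_eq, Finsupp.mem_support_iff]
      rw [← h, Finsupp.finsetSum_apply]
      refine (Finset.sum_pos' (fun _ _ => Nat.zero_le _) ⟨c.1, c.2, ?_⟩).ne'
      simp
    · rintro T ⟨h1, -⟩ T' ⟨h1', -⟩ e
      funext c
      by_cases hc : c ∈ D
      · exact congrFun e ⟨c, hc⟩
      · rw [h1.1 c hc, h1'.1 c hc]
  · intro d
    simp only [semistandardFillings, Set.mem_ofPred_eq, and_assoc]
    rfl

/-! ### Ribbon Schur functions as generating functions of words -/

section Ribbon

/-- The cells of a ribbon, read along the ribbon after the cell `p`; the marks tell whether a step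
goes up or to the right. -/
def pathCells : ℤ × ℤ → List Bool → List (ℤ × ℤ)
  | _, [] => []
  | p, true :: bs => (p.1 - 1, p.2) :: pathCells (p.1 - 1, p.2) bs
  | p, false :: bs => (p.1, p.2 + 1) :: pathCells (p.1, p.2 + 1) bs

@[simp] theorem length_pathCells (p : ℤ × ℤ) (bs : List Bool) :
    (pathCells p bs).length = bs.length := by
  induction bs generalizing p with
  | nil => rfl
  | cons b bs ih => cases b <;> simp [pathCells, ih]

theorem lt_of_mem_pathCells {p z : ℤ × ℤ} {bs : List Bool} (hz : z ∈ pathCells p bs) :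
    p.2 - p.1 < z.2 - z.1 := by
  induction bs generalizing p with
  | nil => simp [pathCells] at hz
  | cons b bs ih =>
    cases b <;> simp only [pathCells, List.mem_cons] at hz <;> rcases hz with rfl | hz
    · simp only; omega
    · have := ih hz; simp only at this; omega
    · simp only; omega
    · have := ih hz; simp only at this; omega

theorem nodup_pathCells (p : ℤ × ℤ) (bs : List Bool) : (pathCells p bs).Nodup := by
  induction bs generalizing p with
  | nil => simp [pathCells]
  | cons b bs ih =>
    cases b <;> simp only [pathCells, List.nodup_cons, ih, and_true] <;> intro h <;>
      exact lt_irrefl _ (lt_of_mem_pathCells h)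

theorem partStarts_pathCells {r : ℕ} (c : Fin r) (T : ℤ × ℤ → ℕ) (p : ℤ × ℤ) (bs : List Bool) :
    partStarts letterRel (some (c, T p)) ((pathCells p bs).map fun z => (c, T z)) =
        bs.map (fun b => (c, b)) ↔
      ∀ z ∈ p :: pathCells p bs,
        ((z.1, z.2 + 1) ∈ p :: pathCells p bs → T z ≤ T (z.1, z.2 + 1)) ∧
        ((z.1 + 1, z.2) ∈ p :: pathCells p bs → T z < T (z.1 + 1, z.2)) := by
  induction bs generalizing p with
  | nil => simp [pathCells, partStarts, Prod.ext_iff]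
  | cons b bs ih =>
    obtain ⟨q, hq, hqd⟩ : ∃ q, pathCells p (b :: bs) = q :: pathCells q bs ∧
        (b = true ∧ q = (p.1 - 1, p.2) ∨ b = false ∧ q = (p.1, p.2 + 1)) := by
      cases b
      · exact ⟨_, rfl, by simp⟩
      · exact ⟨_, rfl, by simp⟩
    rw [hq]
    have hd : q.2 - q.1 = p.2 - p.1 + 1 := by
      rcases hqd with ⟨-, rfl⟩ | ⟨-, rfl⟩ <;> simp only <;> ring
    have hrest : ∀ {z}, z ∈ pathCells q bs → q.2 - q.1 < z.2 - z.1 := lt_of_mem_pathCells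
    have hmem : ∀ {z}, z ∈ q :: pathCells q bs → q.2 - q.1 ≤ z.2 - z.1 := by
      intro z hz
      rcases List.mem_cons.1 hz with rfl | hz
      · exact le_rfl
      · exact (hrest hz).le
    have hL : partStarts letterRel (some (c, T p)) ((q :: pathCells q bs).map fun z => (c, T z)) =
        (b :: bs).map (fun b => (c, b)) ↔ ((!decide (T p ≤ T q)) = b) ∧
        partStarts letterRel (some (c, T q)) ((pathCells q bs).map fun z => (c, T z)) =
        bs.map (fun b => (c, b)) := by
      simp [partStarts, startsPart, letterRel]
    rw [hL, ih]
    have hstep : ((!decide (T p ≤ T q)) = b) ↔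
        (q = (p.1, p.2 + 1) → T p ≤ T q) ∧ (p = (q.1 + 1, q.2) → T q < T p) := by
      rcases hqd with ⟨rfl, rfl⟩ | ⟨rfl, rfl⟩
      · simp [Prod.ext_iff]
      · simp [Prod.ext_iff]
    rw [hstep]
    constructor
    · rintro ⟨⟨h1, h2⟩, h3⟩ z hz
      rcases List.mem_cons.1 hz with rfl | hz
      · refine ⟨fun h => ?_, fun h => ?_⟩
        · rcases List.mem_cons.1 h with h | h
          · simp [Prod.ext_iff] at h
          · rcases List.mem_cons.1 h with h | h
            · rw [h]; exact h1 h.symm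
            · have := hrest h; simp only at this; omega
        · rcases List.mem_cons.1 h with h | h
          · simp [Prod.ext_iff] at h
          · have := hmem h; simp only at this; omega
      · refine ⟨fun h => ?_, fun h => ?_⟩
        · rcases List.mem_cons.1 h with h | h
          · have := hmem hz; rw [← h] at hd; simp only at hd; omega
          · exact (h3 z hz).1 h
        · rcases List.mem_cons.1 h with hp | h
          · rcases List.mem_cons.1 hz with rfl | hz
            · rw [hp]; exact h2 hp.symm
            · have := hrest hz; rw [← hp] at hd; simp only at hd; omega
          · exact (h3 z hz).2 h
    · intro h
      refine ⟨⟨fun e => ?_, fun e => ?_⟩, fun z hz => ⟨fun h' => ?_, fun h' => ?_⟩⟩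
      · have := (h p (by simp)).1
        rw [← e] at this
        exact this (by simp)
      · have := (h q (by simp)).2
        rw [← e] at this
        exact this (by simp)
      · exact (h z (List.mem_cons_of_mem _ hz)).1 (List.mem_cons_of_mem _ h')
      · exact (h z (List.mem_cons_of_mem _ hz)).2 (List.mem_cons_of_mem _ h')

theorem mem_pathCells_replicate {q z : ℤ × ℤ} {k : ℕ} {bs : List Bool} :
    z ∈ pathCells q (List.replicate k false ++ bs) ↔
      (∃ i < k, z = (q.1, q.2 + ((i + 1 : ℕ) : ℤ))) ∨ z ∈ pathCells (q.1, q.2 + (k : ℤ)) bs := by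
  induction k generalizing q with
  | zero => simp
  | succ k ih =>
    simp only [List.replicate_succ, List.cons_append, pathCells, List.mem_cons, ih]
    have e : q.2 + 1 + (k : ℤ) = q.2 + ((k + 1 : ℕ) : ℤ) := by push_cast; ring
    rw [e, ← or_assoc]
    refine or_congr_left ⟨?_, ?_⟩
    · rintro (rfl | ⟨i, hi, rfl⟩)
      · exact ⟨0, by omega, by simp⟩
      · exact ⟨i + 1, by omega, by push_cast; ring_nf⟩
    · rintro ⟨i, hi, rfl⟩
      rcases i with _ | i
      · simp
      · exact Or.inr ⟨i, by omega, by push_cast; ring_nf⟩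

/-- The marks of a composition, all of whose parts have the same color. -/
theorem expandParts_map {r : ℕ} (c : Fin r) (b : List ℕ) :
    expandParts (b.map fun a => (a, c)) =
      (b.flatMap fun a => true :: List.replicate (a - 1) false).map fun x => (c, x) := by
  induction b with
  | nil => rfl
  | cons a b ih => simp [expandParts_cons, ih]

theorem ribbonAux_eq {b : List ℕ} (hb : ∀ a ∈ b, 0 < a) (p : ℤ × ℤ) :
    ribbonAux b p =
      (pathCells (p.1 + 1, p.2) (b.flatMap fun a => true :: List.replicate (a - 1) false)).toFinset := by
  induction b generalizing p with
  | nil => rfl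
  | cons a b ih =>
    have ha := hb a (by simp)
    ext z
    rw [ribbonAux, ih fun x hx => hb x (by simp [hx])]
    simp only [Finset.mem_union, Finset.mem_image, Finset.mem_range, List.mem_toFinset,
      List.flatMap_cons, List.cons_append, pathCells, List.mem_cons, mem_pathCells_replicate,
      add_sub_cancel_right, sub_add_cancel]
    rw [← or_assoc]
    have e : p.2 + ((a - 1 : ℕ) : ℤ) = p.2 + (a : ℤ) - 1 := by push_cast [ha]; ring
    rw [e]
    refine or_congr_left ⟨?_, ?_⟩
    · rintro ⟨i, hi, rfl⟩
      rcases i with _ | i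
      · simp
      · exact Or.inr ⟨i, by omega, rfl⟩
    · rintro (rfl | ⟨i, hi, rfl⟩)
      · exact ⟨0, ha, by simp⟩
      · exact ⟨i + 1, by omega, rfl⟩

/-- The content of a colored word. -/
noncomputable def content {r : ℕ} (w : List (Fin r × ℕ)) : Fin r × ℕ →₀ ℕ :=
  (w.map fun x => Finsupp.single x 1).sum

variable {r : ℕ}

theorem mem_semistandardFillings_iff {b : List ℕ} (hb : ∀ a ∈ b, 0 < a) (hb' : b ≠ [])
    (c : Fin r) {bs : List Bool}
    (hbs : bs = b.flatMap fun a => true :: List.replicate (a - 1) false) {T : ℤ × ℤ → ℕ} :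
    T ∈ semistandardFillings (ribbonOfList b) ↔
      (∀ z ∉ pathCells (1, 0) bs, T z = 0) ∧
      partStarts letterRel none ((pathCells (1, 0) bs).map fun z => (c, T z)) =
        bs.map fun x => (c, x) := by
  have hD : ribbonOfList b = (pathCells (1, 0) bs).toFinset := by
    rw [ribbonOfList, ribbonAux_eq hb, hbs]; rfl
  obtain ⟨bs', rfl⟩ : ∃ bs', bs = true :: bs' := by
    rcases b with _ | ⟨a, b⟩
    · exact absurd rfl hb'
    · exact ⟨_, hbs⟩
  have h1 : pathCells (1, 0) (true :: bs') = (0, 0) :: pathCells (0, 0) bs' := rfl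
  simp only [semistandardFillings, hD, Set.mem_ofPred_eq, List.mem_toFinset]
  rw [h1]
  simp only [List.map_cons, partStarts, startsPart, List.cons.injEq, true_and,
    partStarts_pathCells]
  refine and_congr_right fun _ => ?_
  constructor
  · exact fun h z hz => ⟨h.1 z hz, h.2 z hz⟩
  · exact fun h => ⟨fun z hz => (h z hz).1, fun z hz => (h z hz).2⟩

/-- A ribbon Schur function is the generating function of the words with a given descent set. -/
theorem isGenFun_ribbon {b : List ℕ} (hb : ∀ a ∈ b, 0 < a) (hb' : b ≠ []) (c : Fin r) :
    IsGenFun {u : List (Fin r × ℕ) |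
        partStarts letterRel none u = expandParts (b.map fun a => (a, c))}
      content (skewSchurIn c (ribbonOfList b)) := by
  rw [expandParts_map]
  obtain ⟨bs, hbs⟩ : ∃ bs, bs = b.flatMap fun a => true :: List.replicate (a - 1) false := ⟨_, rfl⟩
  rw [← hbs]
  have hD : ribbonOfList b = (pathCells (1, 0) bs).toFinset := by
    rw [ribbonOfList, ribbonAux_eq hb, hbs]; rfl
  refine (isGenFun_skewSchurIn c (ribbonOfList b)).congr
    (fun T => (pathCells (1, 0) bs).map fun z => (c, T z)) ⟨?_, ?_, ?_⟩ ?_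
  · intro T hT
    exact ((mem_semistandardFillings_iff hb hb' c hbs).1 hT).2
  · intro T hT T' hT' e
    rw [mem_semistandardFillings_iff hb hb' c hbs] at hT hT'
    funext z
    by_cases hz : z ∈ pathCells (1, 0) bs
    · have := List.map_inj_left.1 e z hz
      exact (Prod.mk.inj this).2
    · rw [hT.1 z hz, hT'.1 z hz]
  · intro u hu
    have hlen : u.length = (pathCells (1, 0) bs).length := by
      have := congrArg List.length (hu : _ = _)
      simpa using this
    have hcol : ∀ x ∈ u, x.1 = c := by
      have h1 := congrArg (List.map Prod.fst) (hu : _ = _)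
      rw [map_fst_partStarts] at h1
      intro x hx
      have h2 : x.1 ∈ u.map Prod.fst := List.mem_map_of_mem hx
      rw [h1] at h2
      simp only [List.map_map, List.mem_map, Function.comp] at h2
      obtain ⟨_, _, h2⟩ := h2
      exact h2.symm
    obtain ⟨T, hT⟩ : ∃ T : ℤ × ℤ → ℕ, ∀ z, T z =
        if z ∈ pathCells (1, 0) bs then
          (u.getD ((pathCells (1, 0) bs).idxOf z) (c, 0)).2 else 0 := ⟨_, fun _ => rfl⟩
    have hmap : (pathCells (1, 0) bs).map (fun z => (c, T z)) = u := by
      refine List.ext_getElem (by simp [hlen]) fun i h1 h2 => ?_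
      have h3 : i < (pathCells (1, 0) bs).length := by omega
      rw [List.getElem_map, hT, if_pos (List.getElem_mem h3),
        (nodup_pathCells _ _).idxOf_getElem, List.getD_eq_getElem _ _ h2]
      exact Prod.ext (hcol _ (List.getElem_mem h2)).symm rfl
    refine ⟨T, ?_, hmap⟩
    rw [mem_semistandardFillings_iff hb hb' c hbs, hmap]
    exact ⟨fun z hz => by rw [hT, if_neg hz], hu⟩
  · intro T _
    rw [hD, List.sum_toFinset _ (nodup_pathCells _ _), content, List.map_map]
    rfl

theorem partStarts_some {y : Fin r × ℕ} {v : List (Fin r × ℕ)} (h : ∀ x ∈ v.head?, x.1 ≠ y.1) :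
    partStarts letterRel (some y) v = partStarts letterRel none v := by
  rcases v with _ | ⟨x, v⟩
  · rfl
  · have := h x (by simp)
    simp [partStarts, startsPart, letterRel, this.symm]

/-- The colored composition with the given monochromatic blocks. -/
def joinBlocks (L : List (List ℕ × Fin r)) : List (ℕ × Fin r) :=
  L.flatMap fun b => b.1.map fun a => (a, b.2)

theorem isGenFun_joinBlocks {L : List (List ℕ × Fin r)} (hL : L.IsChain fun b b' => b.2 ≠ b'.2)
    (hne : ∀ b ∈ L, b.1 ≠ []) (hpos : ∀ b ∈ L, ∀ a ∈ b.1, 0 < a) :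
    IsGenFun {v : List (Fin r × ℕ) | partStarts letterRel none v = expandParts (joinBlocks L)}
      content (L.map fun b => skewSchurIn b.2 (ribbonOfList b.1)).prod := by
  induction L with
  | nil =>
    have := IsGenFun.one (wt := content (r := r)) [] rfl
    convert this using 1
    · ext v
      simp only [joinBlocks, List.flatMap_nil, expandParts_nil, Set.mem_ofPred_eq,
        Set.mem_singleton_iff]
      rw [← List.length_eq_zero_iff, length_partStarts, List.length_eq_zero_iff]
    · rfl
  | cons b L ih =>
    have hL' := ih hL.tail (fun x hx => hne x (by simp [hx])) (fun x hx => hpos x (by simp [hx]))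
    have hb := isGenFun_ribbon (hpos b (by simp)) (hne b (by simp)) b.2
    have hcol : ∀ u : List (Fin r × ℕ),
        u.map Prod.fst = (expandParts (b.1.map fun a => (a, b.2))).map Prod.fst →
        ∀ y ∈ u.getLast?, y.1 = b.2 := by
      intro u hu y hy
      have h2 : y.1 ∈ u.map Prod.fst := List.mem_map_of_mem (List.mem_of_mem_getLast? hy)
      rw [hu, expandParts_map] at h2
      simp only [List.map_map, List.mem_map, Function.comp] at h2
      obtain ⟨_, _, h2⟩ := h2
      exact h2.symm
    have hhead : ∀ v : List (Fin r × ℕ),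
        v.map Prod.fst = (expandParts (joinBlocks L)).map Prod.fst →
        ∀ x ∈ v.head?, x.1 ≠ b.2 := by
      intro v hv x hx
      have h1 : (v.map Prod.fst).head? = some x.1 := by
        rw [List.head?_map, hx]; rfl
      rw [hv] at h1
      rcases L with _ | ⟨b', L⟩
      · simp [joinBlocks] at h1
      · have h2 : b.2 ≠ b'.2 := (List.isChain_cons_cons.1 hL).1
        obtain ⟨a, bb, hab⟩ := List.exists_cons_of_ne_nil (hne b' (by simp))
        simp only [joinBlocks, List.flatMap_cons, hab, List.map_cons, List.cons_append,
          expandParts_cons, List.head?_cons, Option.some.injEq] at h1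
        rw [← h1]
        exact h2.symm
    have hjoin : ∀ u v : List (Fin r × ℕ),
        u.map Prod.fst = (expandParts (b.1.map fun a => (a, b.2))).map Prod.fst →
        v.map Prod.fst = (expandParts (joinBlocks L)).map Prod.fst →
        partStarts letterRel none (u ++ v) =
          partStarts letterRel none u ++ partStarts letterRel none v := by
      intro u v hu hv
      rw [partStarts_append]
      congr 1
      rcases hy : u.getLast? with _ | y
      · rfl
      · refine partStarts_some fun x hx => ?_
        rw [hcol u hu y hy]
        exact hhead v hv x hx
    have hE : expandParts (joinBlocks (b :: L)) =
        expandParts (b.1.map fun a => (a, b.2)) ++ expandParts (joinBlocks L) := by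
      rw [← expandParts_append]; rfl
    have hfst : ∀ {v : List (Fin r × ℕ)} {p E}, partStarts letterRel p v = E →
        v.map Prod.fst = E.map Prod.fst := by
      rintro v p _ rfl
      rw [map_fst_partStarts]
    rw [List.map_cons, List.prod_cons, hE]
    refine (hb.mul hL').congr (fun p => p.1 ++ p.2) ⟨?_, ?_, ?_⟩ ?_
    · rintro ⟨u, v⟩ ⟨hu, hv⟩
      simp only [Set.mem_ofPred_eq] at hu hv ⊢
      rw [hjoin u v (hfst hu) (hfst hv), hu, hv]
    · rintro ⟨u, v⟩ ⟨hu, hv⟩ ⟨u', v'⟩ ⟨hu', hv'⟩ e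
      simp only [Set.mem_ofPred_eq] at hu hv hu' hv' e
      have h1 : u.length = u'.length := by
        have := congrArg List.length (hu.trans hu'.symm)
        simpa using this
      obtain ⟨rfl, rfl⟩ := List.append_inj e h1
      rfl
    · intro z hz
      obtain ⟨k, hk⟩ : ∃ k, k = (expandParts (b.1.map fun a => (a, b.2))).length := ⟨_, rfl⟩
      have hz' : partStarts letterRel none (z.take k ++ z.drop k) = _ :=
        (List.take_append_drop k z).symm ▸ (hz : partStarts letterRel none z = _)
      have hlen := congrArg List.length (hz : partStarts letterRel none z = _)
      rw [length_partStarts, List.length_append, ← hk] at hlen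
      have hz2 := hz'
      rw [partStarts_append] at hz2
      obtain ⟨h1, h2⟩ := List.append_inj hz2 (by
        rw [length_partStarts, List.length_take, ← hk]; omega)
      rw [hjoin _ _ (hfst h1) (hfst h2)] at hz'
      obtain ⟨h3, h4⟩ := List.append_inj hz' (by
        rw [length_partStarts, List.length_take, ← hk]; omega)
      exact ⟨(z.take k, z.drop k), ⟨h3, h4⟩, List.take_append_drop k z⟩
    · rintro ⟨u, v⟩ -
      simp [content]

theorem rainbow_spec (l : List (ℕ × Fin r)) :
    joinBlocks (rainbow l) = l ∧ ((rainbow l).IsChain fun b b' => b.2 ≠ b'.2) ∧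
      ∀ b ∈ rainbow l, b.1 ≠ [] := by
  induction l with
  | nil => simp [rainbow, joinBlocks]
  | cons p l ih =>
    obtain ⟨a, c⟩ := p
    rw [rainbow]
    rcases h : rainbow l with _ | ⟨⟨b, c'⟩, bs⟩
    · rw [h] at ih
      simp only [joinBlocks, List.flatMap_nil] at ih
      simp [joinBlocks, ← ih.1]
    · rw [h] at ih
      obtain ⟨h1, h2, h3⟩ := ih
      simp only
      split_ifs with hc
      · subst hc
        refine ⟨by rw [← h1]; rfl, ?_, ?_⟩
        · rw [List.isChain_cons] at h2 ⊢
          exact h2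
        · intro x hx
          rcases List.mem_cons.1 hx with rfl | hx
          · simp
          · exact h3 x (by simp [hx])
      · refine ⟨by rw [← h1]; rfl, List.isChain_cons_cons.2 ⟨hc, h2⟩, ?_⟩
        intro x hx
        rcases List.mem_cons.1 hx with rfl | hx
        · simp
        · exact h3 x hx

/-- A colored ribbon Schur function is the generating function of the colored words with a given
colored descent composition. -/
theorem isGenFun_colRibbon {l : List (ℕ × Fin r)} (hl : ∀ p ∈ l, 0 < p.1) :
    IsGenFun {v : List (Fin r × ℕ) | partStarts letterRel none v = expandParts l}
      content (colRibbon l) := by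
  obtain ⟨h1, h2, h3⟩ := rainbow_spec l
  have := isGenFun_joinBlocks h2 h3 (by
    intro b hb a ha
    refine hl (a, b.2) ?_
    rw [← h1]
    exact List.mem_flatMap.2 ⟨b, hb, List.mem_map_of_mem ha⟩)
  rwa [h1] at this

end Ribbon

/-! ### Semistandard tableaux and triangular arrays -/

theorem lt_card_filter_iff {m t c : ℕ} {g : ℕ → ℕ} (hg : ∀ a, a + 1 < m → g a ≤ g (a + 1))
    (hc : c < m) : c < ((Finset.range m).filter fun a => g a < t).card ↔ g c < t := by
  have hmono : ∀ a b, a ≤ b → b < m → g a ≤ g b := by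
    intro a b hab
    induction b, hab using Nat.le_induction with
    | base => exact fun _ => le_rfl
    | succ b hab ih => exact fun hb => (ih (by omega)).trans (hg b hb)
  constructor
  · intro h
    by_contra hlt
    have hsub : (Finset.range m).filter (fun a => g a < t) ⊆ Finset.range c := by
      intro a ha
      simp only [Finset.mem_filter, Finset.mem_range] at ha ⊢
      by_contra hac
      have := hmono c a (by omega) ha.1
      omega
    have := Finset.card_le_card hsub
    rw [Finset.card_range] at this
    omega
  · intro h
    have hsub : Finset.range (c + 1) ⊆ (Finset.range m).filter (fun a => g a < t) := by
      intro a ha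
      simp only [Finset.mem_filter, Finset.mem_range] at ha ⊢
      have := hmono a c (by omega) hc
      omega
    have := Finset.card_le_card hsub
    rw [Finset.card_range] at this
    omega

/-- The number of entries `< t` in row `i` of the filling `T` of a Young diagram. -/
def rowCounts (μ : YoungDiagram) (T : ℤ × ℤ → ℕ) (i t : ℕ) : ℕ :=
  ((Finset.range (μ.rowLen i)).filter fun c : ℕ => T ((i : ℤ), (c : ℤ)) < t).card

section Shape

variable {r : ℕ} {lam : Fin r → YoungDiagram} {j : Fin r} {N : ℕ}

theorem card_filter_shOf (h : ∀ i, N ≤ i → (lam j).rowLen i = 0) (p : ℤ × ℤ → Prop)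
    [DecidablePred p] :
    ((shOf lam j).filter p).card = ∑ i ∈ Finset.range N,
      ((Finset.range ((lam j).rowLen i)).filter fun c : ℕ => p ((i : ℤ), (c : ℤ))).card := by
  rw [← Finset.card_sigma, ← Finset.card_image_of_injective (f := fun x : Σ _ : ℕ, ℕ =>
    ((x.1 : ℤ), (x.2 : ℤ)))]
  · congr 1
    ext z
    simp only [Finset.mem_filter, mem_shOf, Finset.mem_image, Finset.mem_sigma, Finset.mem_range,
      Sigma.exists]
    constructor
    · rintro ⟨⟨i, c, hc, rfl⟩, hz⟩
      refine ⟨i, c, ⟨?_, hc, hz⟩, rfl⟩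
      by_contra hi
      rw [h i (by omega)] at hc
      omega
    · rintro ⟨i, c, ⟨_, hc, hz⟩, rfl⟩
      exact ⟨⟨i, c, hc, rfl⟩, hz⟩
  · rintro ⟨i, c⟩ ⟨i', c'⟩ e
    simp only [Prod.mk.injEq, Nat.cast_inj] at e
    obtain ⟨rfl, rfl⟩ := e
    rfl

theorem card_eq_sum_rowLen (h : ∀ i, N ≤ i → (lam j).rowLen i = 0) :
    (lam j).card = ∑ i ∈ Finset.range N, (lam j).rowLen i := by
  have h1 := card_filter_shOf h (fun _ => True)
  simp only [Finset.filter_true, Finset.card_range] at h1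
  rw [← h1, shOf, Finset.card_image_of_injective]
  rintro ⟨i, c⟩ ⟨i', c'⟩ e
  simpa using e

variable {T : ℤ × ℤ → ℕ}

theorem lt_rowCounts_iff (hT : T ∈ semistandardFillings (shOf lam j)) {i c t : ℕ}
    (hc : c < (lam j).rowLen i) :
    c < rowCounts (lam j) T i t ↔ T ((i : ℤ), (c : ℤ)) < t := by
  refine lt_card_filter_iff (g := fun c : ℕ => T ((i : ℤ), (c : ℤ))) (fun a ha => ?_) hc
  have := hT.2.1 ((i : ℤ), (a : ℤ)) (mem_shOf.2 ⟨i, a, by omega, rfl⟩)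
    (mem_shOf.2 ⟨i, a + 1, ha, by push_cast; rfl⟩)
  simpa using this

theorem eq_of_rowCounts_eq {T' : ℤ × ℤ → ℕ} (hT : T ∈ semistandardFillings (shOf lam j))
    (hT' : T' ∈ semistandardFillings (shOf lam j))
    (h : rowCounts (lam j) T = rowCounts (lam j) T') : T = T' := by
  funext z
  by_cases hz : z ∈ shOf lam j
  · obtain ⟨i, c, hc, rfl⟩ := mem_shOf.1 hz
    refine eq_of_forall_gt_iff fun t => ?_
    rw [← lt_rowCounts_iff hT hc, h, lt_rowCounts_iff hT' hc]
  · rw [hT.1 z hz, hT'.1 z hz]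

theorem rowCounts_of_le (hN : ∀ c ∈ shOf lam j, T c < N) {i t : ℕ} (ht : N ≤ t) :
    rowCounts (lam j) T i t = (lam j).rowLen i := by
  rw [rowCounts, Finset.filter_true_of_mem, Finset.card_range]
  intro c hc
  exact (hN _ (mem_shOf.2 ⟨i, c, Finset.mem_range.1 hc, rfl⟩)).trans_le ht

theorem isGT_rowCounts (hT : T ∈ semistandardFillings (shOf lam j))
    (hN : ∀ c ∈ shOf lam j, T c < N) : IsGT N (rowCounts (lam j) T) where
  zero i := by simp [rowCounts]
  mono i t := Finset.card_le_card (Finset.monotone_filter_right _ fun c _ h => Nat.lt_succ_of_lt h)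
  inter i t := by
    refine Finset.card_le_card fun c hc => ?_
    simp only [Finset.mem_filter, Finset.mem_range] at hc ⊢
    have h1 : c < (lam j).rowLen i := hc.1.trans_le ((lam j).rowLen_anti i (i + 1) (by omega))
    have := hT.2.2 ((i : ℤ), (c : ℤ)) (mem_shOf.2 ⟨i, c, h1, rfl⟩)
      (mem_shOf.2 ⟨i + 1, c, hc.1, by push_cast; rfl⟩)
    push_cast at hc
    simp only at this
    omega
  const i t ht := by rw [rowCounts_of_le hN ht, rowCounts_of_le hN (by omega)]

theorem exists_rowCounts_eq {f : ℕ → ℕ → ℕ} (hf : IsGT N f) (hfN : ∀ i, f i N = (lam j).rowLen i) :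
    ∃ T ∈ semistandardFillings (shOf lam j),
      (∀ c ∈ shOf lam j, T c < N) ∧ rowCounts (lam j) T = f := by
  classical
  obtain ⟨T, hT⟩ : ∃ T : ℤ × ℤ → ℕ, ∀ z, T z = if z ∈ shOf lam j then
      sInf {t | z.2.toNat < f z.1.toNat (t + 1)} else 0 := ⟨_, fun _ => rfl⟩
  have hle : ∀ i t, f i t ≤ f i N := fun i t => by
    rcases le_total t N with h | h
    · exact hf.mono_le i h
    · exact (hf.eq_of_le i h).le
  have key : ∀ i c t : ℕ, c < (lam j).rowLen i → (T ((i : ℤ), (c : ℤ)) < t ↔ c < f i t) := by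
    intro i c t hc
    have hN : N ≠ 0 := by
      rintro rfl
      have := hfN i
      rw [hf.zero] at this
      omega
    obtain ⟨M, rfl⟩ : ∃ M, N = M + 1 := Nat.exists_eq_succ_of_ne_zero hN
    have hne : {t | c < f i (t + 1)}.Nonempty := ⟨M, by
      have := hfN i
      simp only [Set.mem_ofPred_eq]
      omega⟩
    have hTc : T ((i : ℤ), (c : ℤ)) = sInf {t | c < f i (t + 1)} := by
      rw [hT, if_pos (mem_shOf.2 ⟨i, c, hc, rfl⟩)]
      simp
    rw [hTc]
    constructor
    · intro h
      exact (show c < f i _ from Nat.sInf_mem hne).trans_le (hf.mono_le i h)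
    · intro h
      rcases t with _ | t
      · rw [hf.zero] at h; omega
      · exact Nat.lt_succ_of_le (Nat.sInf_le h)
  refine ⟨T, ⟨fun c hc => by rw [hT, if_neg hc], ?_, ?_⟩, ?_, ?_⟩
  · rintro z hz hz'
    obtain ⟨i, c, hc, rfl⟩ := mem_shOf.1 hz
    have e : (((i : ℤ), (c : ℤ) + 1) : ℤ × ℤ) = ((i : ℤ), ((c + 1 : ℕ) : ℤ)) := by push_cast; rfl
    simp only [e] at hz' ⊢
    have hc' : c + 1 < (lam j).rowLen i := coe_mem_shOf.1 hz'
    have := (key i (c + 1) _ hc').1 (Nat.lt_succ_self _)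
    exact Nat.lt_succ_iff.1 ((key i c _ hc).2 (by omega))
  · rintro z hz hz'
    obtain ⟨i, c, hc, rfl⟩ := mem_shOf.1 hz
    have e : (((i : ℤ) + 1, (c : ℤ)) : ℤ × ℤ) = (((i + 1 : ℕ) : ℤ), (c : ℤ)) := by push_cast; rfl
    simp only [e] at hz' ⊢
    have hc' : c < (lam j).rowLen (i + 1) := coe_mem_shOf.1 hz'
    exact (key i c _ hc).2
      (((key (i + 1) c _ hc').1 (Nat.lt_succ_self _)).trans_le (hf.inter i _))
  · rintro z hz
    obtain ⟨i, c, hc, rfl⟩ := mem_shOf.1 hz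
    rw [key i c N hc, hfN]
    exact hc
  · funext i t
    have : ((Finset.range ((lam j).rowLen i)).filter fun c : ℕ => T ((i : ℤ), (c : ℤ)) < t) =
        Finset.range (f i t) := by
      ext c
      simp only [Finset.mem_filter, Finset.mem_range]
      constructor
      · exact fun h => (key i c t h.1).1 h.2
      · intro h
        have hc : c < (lam j).rowLen i := by
          have := hle i t
          rw [hfN] at this
          omega
        exact ⟨hc, (key i c t hc).2 h⟩
    rw [rowCounts, this, Finset.card_range]

theorem rowLen_eq_zero {f : ℕ → ℕ → ℕ} (hf : IsGT N f) (hfN : ∀ i, f i N = (lam j).rowLen i)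
    (i : ℕ) (hi : N ≤ i) : (lam j).rowLen i = 0 := by
  rw [← hfN, hf.eq_zero_of_le hi]

end Shape

/-! ### Contents and their partial sums -/

section Content

variable {r : ℕ}

theorem finsupp_eq_iff_sum_range {d d' : Fin r × ℕ →₀ ℕ} :
    d = d' ↔ ∀ j t, ∑ a ∈ Finset.range t, d (j, a) = ∑ a ∈ Finset.range t, d' (j, a) := by
  refine ⟨fun h => by simp [h], fun h => Finsupp.ext ?_⟩
  rintro ⟨j, a⟩
  have h1 := h j a
  have h2 := h j (a + 1)
  rw [Finset.sum_range_succ, Finset.sum_range_succ] at h2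
  omega

theorem sum_range_content (w : List (Fin r × ℕ)) (j : Fin r) (t : ℕ) :
    ∑ a ∈ Finset.range t, content w (j, a) = w.countP fun x => x.1 = j ∧ x.2 < t := by
  induction w with
  | nil => simp [content]
  | cons x w ih =>
    have h1 : content (x :: w) = Finsupp.single x 1 + content w := by simp [content]
    have h2 : ∑ a ∈ Finset.range t, (Finsupp.single x 1 : Fin r × ℕ →₀ ℕ) (j, a) =
        if x.1 = j ∧ x.2 < t then 1 else 0 := by
      obtain ⟨k, b⟩ := x
      simp only [Finsupp.single_apply, Prod.mk.injEq]
      by_cases hk : k = j <;> simp [hk]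
    simp only [h1, Finsupp.add_apply, Finset.sum_add_distrib, ih, h2, List.countP_cons,
      decide_eq_true_eq]
    rw [add_comm]

theorem content_reverse (w : List (Fin r × ℕ)) : content w.reverse = content w := by
  simp [content, List.sum_reverse]

theorem content_pos {w : List (Fin r × ℕ)} {x : Fin r × ℕ} (hx : x ∈ w) : content w x ≠ 0 := by
  induction w with
  | nil => simp at hx
  | cons y w ih =>
    have h1 : content (y :: w) = Finsupp.single y 1 + content w := by simp [content]
    rw [h1, Finsupp.add_apply]
    rcases List.mem_cons.1 hx with rfl | hx
    · simp
    · have := ih hx; omega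

theorem sum_range_tableauContent {lam : Fin r → YoungDiagram} (T : Fin r → ℤ × ℤ → ℕ) (j : Fin r)
    (t : ℕ) :
    ∑ a ∈ Finset.range t, (∑ j', ∑ c ∈ shOf lam j', Finsupp.single (j', T j' c) 1 :
      Fin r × ℕ →₀ ℕ) (j, a) = ((shOf lam j).filter fun c => T j c < t).card := by
  simp only [Finsupp.finsetSum_apply, Finsupp.single_apply, Prod.mk.injEq]
  rw [Finset.sum_comm, Finset.sum_eq_single j, Finset.sum_comm, Finset.card_filter]
  · refine Finset.sum_congr rfl fun c _ => ?_
    simp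
  · intro j' _ hj
    simp [hj]
  · simp

/-- The tuples of triangular arrays of the `r`-partite semistandard tableaux of shape `lam` and
content `d`. -/
def gtTuples (N : ℕ) (d : Fin r × ℕ →₀ ℕ) (lam : Fin r → YoungDiagram) :
    Set (Fin r → ℕ → ℕ → ℕ) :=
  {F | (∀ j, IsGT N (F j)) ∧ (∀ j i, F j i N = (lam j).rowLen i) ∧
    ∀ j t, ∑ i ∈ Finset.range N, F j i t = ∑ a ∈ Finset.range t, d (j, a)}

theorem coeff_prod_skewSchurIn {N : ℕ} {d : Fin r × ℕ →₀ ℕ} (hd : ∀ x, d x ≠ 0 → x.2 < N)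
    (lam : Fin r → YoungDiagram) :
    MvPowerSeries.coeff d (∏ j, skewSchurIn j (shOf lam j)) = ((gtTuples N d lam).ncard : ℤ) := by
  rw [(IsGenFun.prod fun j => isGenFun_skewSchurIn j (shOf lam j)).coeff_eq]
  have hbound : ∀ T : Fin r → ℤ × ℤ → ℕ,
      ∑ j', ∑ c ∈ shOf lam j', Finsupp.single (j', T j' c) 1 = d →
      ∀ j, ∀ c ∈ shOf lam j, T j c < N := by
    rintro T rfl j c hc
    refine hd (j, T j c) ?_
    simp only [Finsupp.finsetSum_apply]
    refine (Finset.sum_pos' (fun _ _ => Nat.zero_le _) ⟨j, Finset.mem_univ _,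
      Finset.sum_pos' (fun _ _ => Nat.zero_le _) ⟨c, hc, ?_⟩⟩).ne'
    simp
  have hcount : ∀ T : Fin r → ℤ × ℤ → ℕ, (∀ j, IsGT N (rowCounts (lam j) (T j))) →
      (∀ j i, rowCounts (lam j) (T j) i N = (lam j).rowLen i) →
      (∑ j', ∑ c ∈ shOf lam j', Finsupp.single (j', T j' c) 1 = d ↔
        ∀ j t, ∑ i ∈ Finset.range N, rowCounts (lam j) (T j) i t =
          ∑ a ∈ Finset.range t, d (j, a)) := by
    intro T hT hTN
    rw [finsupp_eq_iff_sum_range]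
    simp only [sum_range_tableauContent]
    refine forall₂_congr fun j t => ?_
    rw [card_filter_shOf (rowLen_eq_zero (hT j) (hTN j))]
    rfl
  congr 1
  refine Set.ncard_congr (fun T _ j => rowCounts (lam j) (T j)) ?_ ?_ ?_
  · rintro T ⟨hT, hTd⟩
    have h1 := fun j => isGT_rowCounts (hT j) (hbound T hTd j)
    have h2 := fun j i => rowCounts_of_le (hbound T hTd j) (i := i) le_rfl
    exact ⟨h1, h2, (hcount T h1 h2).1 hTd⟩
  · rintro T T' ⟨hT, -⟩ ⟨hT', -⟩ e
    exact funext fun j => eq_of_rowCounts_eq (hT j) (hT' j) (congrFun e j)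
  · rintro F ⟨h1, h2, h3⟩
    choose T hT hTN hTF using fun j => exists_rowCounts_eq (h1 j) (h2 j)
    have e : (fun j => rowCounts (lam j) (T j)) = F := funext hTF
    refine ⟨T, ⟨hT, ?_⟩, e⟩
    subst e
    exact (hcount T h1 h2).2 h3

/-! ### The decomposition of the set of words by shape -/

/-- The words of content `d` with colored descent composition `l`, read backwards. -/
def descentWords (d : Fin r × ℕ →₀ ℕ) (l : List (ℕ × Fin r)) : Set (List (Fin r × ℕ)) :=
  {w | partStarts letterRel none w.reverse = expandParts l ∧ content w = d}

theorem coeff_colRibbon {l : List (ℕ × Fin r)} (hl : ∀ p ∈ l, 0 < p.1) (d : Fin r × ℕ →₀ ℕ) :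
    (descentWords d l).Finite ∧
      MvPowerSeries.coeff d (colRibbon l) = ((descentWords d l).ncard : ℤ) := by
  have h := (isGenFun_colRibbon hl).congr (S' := {w | partStarts letterRel none w.reverse =
      expandParts l}) (wt' := content) List.reverse
    ⟨fun v hv => by simpa using hv, List.reverse_injective.injOn,
      fun w hw => ⟨w.reverse, hw, w.reverse_reverse⟩⟩ fun v _ => content_reverse v
  exact ⟨h.finite d, h.coeff_eq d⟩

variable {N n : ℕ} {d : Fin r × ℕ →₀ ℕ} {l : List (ℕ × Fin r)}

theorem ncard_descentWords_shape [NeZero r] (hd : ∀ x, d x ≠ 0 → x.2 < N)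
    (hl : ∀ p ∈ l, 0 < p.1) (hsum : (l.map Prod.fst).sum = n) (lam : Fin r → YoungDiagram) :
    {w | w ∈ descentWords d l ∧ ∀ j i, rskP w j i N = (lam j).rowLen i}.ncard =
      {T | IsPartiteSYT (shOf lam) n T ∧ coTab (shOf lam) n T = l}.ncard *
        (gtTuples N d lam).ncard := by
  have hN : ∀ w ∈ descentWords d l, ∀ x ∈ w, x.2 < N := by
    rintro w ⟨-, rfl⟩ x hx
    exact hd x (content_pos hx)
  rw [ncard_partiteSYT hl hsum, ← Set.ncard_prod]
  refine Set.ncard_congr (fun w _ => (rskQ N w, rskP w)) ?_ ?_ ?_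
  · rintro w ⟨hw, hlam⟩
    have hwN := hN w hw
    refine ⟨⟨isLattice_rskQ hwN, fun j i => ?_, ?_⟩, fun j => isGT_rskP hwN j, hlam,
      fun j t => ?_⟩
    · rw [count_rskQ hwN, hlam]
    · rw [partStarts_rskQ hwN, hw.1]
    · rw [sum_rskP hwN, ← hw.2, sum_range_content]
  · rintro w w' ⟨hw, -⟩ ⟨hw', -⟩ e
    obtain ⟨e1, e2⟩ := Prod.mk.inj e
    exact rsk_injective (hN w hw) (hN w' hw') e2 e1
  · rintro ⟨κ, F⟩ ⟨⟨h1, h2, h3⟩, h4, h5, h6⟩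
    obtain ⟨w, hw, rfl, rfl⟩ := rsk_surjective h1 h4 fun j i => (h5 j i).trans (h2 j i).symm
    refine ⟨w, ⟨⟨?_, ?_⟩, h5⟩, rfl⟩
    · rw [← partStarts_rskQ hw, h3]
    · rw [finsupp_eq_iff_sum_range]
      intro j t
      rw [sum_range_content, ← sum_rskP hw, h6]

theorem YoungDiagram.eq_of_rowLen_eq {μ ν : YoungDiagram} (h : ∀ i, μ.rowLen i = ν.rowLen i) :
    μ = ν := by
  refine YoungDiagram.ext (Finset.ext fun z => ?_)
  rw [YoungDiagram.mem_cells, YoungDiagram.mem_cells, YoungDiagram.mem_iff_lt_rowLen,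
    YoungDiagram.mem_iff_lt_rowLen, h]

theorem YoungDiagram.exists_rowLen_eq {f : ℕ → ℕ} (hf : Antitone f) (hN : ∀ i, N ≤ i → f i = 0) :
    ∃ μ : YoungDiagram, ∀ i, μ.rowLen i = f i := by
  refine ⟨⟨(Finset.range N).biUnion fun i => (Finset.range (f i)).image fun c => (i, c), ?_⟩,
    fun i => ?_⟩
  · rintro ⟨i, c⟩ ⟨i', c'⟩ ⟨h1, h2⟩ h
    simp only [Finset.coe_biUnion, Finset.mem_coe, Finset.mem_range, Finset.coe_image,
      Set.mem_iUnion, Set.mem_image, Prod.mk.injEq, exists_prop] at h h1 h2 ⊢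
    obtain ⟨_, hi, _, hc, rfl, rfl⟩ := h
    have := hf h1
    exact ⟨i', by omega, c', by omega, rfl, rfl⟩
  · refine eq_of_forall_lt_iff fun c => ?_
    rw [← YoungDiagram.mem_iff_lt_rowLen, ← YoungDiagram.mem_cells]
    simp only [Finset.mem_biUnion, Finset.mem_range, Finset.mem_image, Prod.mk.injEq]
    constructor
    · rintro ⟨_, _, _, hc, rfl, rfl⟩
      exact hc
    · intro hc
      refine ⟨i, ?_, c, hc, rfl, rfl⟩
      by_contra hi
      rw [hN i (by omega)] at hc
      omega

theorem sum_countP_color (w : List (Fin r × ℕ)) :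
    ∑ j, w.countP (fun x => x.1 = j) = w.length := by
  induction w with
  | nil => simp
  | cons x w ih => simp [List.countP_cons, Finset.sum_add_distrib, ih]

theorem exists_shape (hd : ∀ x, d x ≠ 0 → x.2 < N) (hl : ∀ p ∈ l, 0 < p.1)
    (hsum : (l.map Prod.fst).sum = n) {w : List (Fin r × ℕ)} (hw : w ∈ descentWords d l) :
    ∃ lam : Fin r → YoungDiagram, ∑ j, (lam j).card = n ∧
      ∀ j i, rskP w j i N = (lam j).rowLen i := by
  have hwN : ∀ x ∈ w, x.2 < N := fun x hx => hd x (hw.2 ▸ content_pos hx)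
  have hgt := fun j => isGT_rskP hwN j
  choose lam hlam using fun j => YoungDiagram.exists_rowLen_eq (N := N)
    (antitone_nat_of_succ_le fun i => (hgt j).antitone_row i N)
    fun i hi => (hgt j).eq_zero_of_le hi
  refine ⟨lam, ?_, fun j i => (hlam j i).symm⟩
  have h1 : ∀ j, (lam j).card = w.countP fun x => x.1 = j := by
    intro j
    rw [card_eq_sum_rowLen (rowLen_eq_zero (hgt j) fun i => (hlam j i).symm)]
    simp only [hlam]
    rw [sum_rskP hwN]
    refine List.countP_congr fun x hx => ?_
    simp [hwN x hx]
  rw [Finset.sum_congr rfl fun j _ => h1 j, sum_countP_color]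
  have := congrArg List.length hw.1
  rw [length_partStarts, List.length_reverse, length_expandParts hl] at this
  rw [this, hsum]

theorem YoungDiagram.cells_subset {μ : YoungDiagram} (h : μ.card ≤ n) :
    μ.cells ⊆ Finset.range n ×ˢ Finset.range n := by
  rintro ⟨i, c⟩ hz
  have h1 : ((Finset.range (i + 1)).image fun a => (a, c)) ⊆ μ.cells := by
    intro z hz'
    obtain ⟨a, ha, rfl⟩ := Finset.mem_image.1 hz'
    rw [Finset.mem_range] at ha
    exact μ.isLowerSet (Prod.mk_le_mk.2 ⟨by omega, le_rfl⟩) hz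
  have h2 : ((Finset.range (c + 1)).image fun a => (i, a)) ⊆ μ.cells := by
    intro z hz'
    obtain ⟨a, ha, rfl⟩ := Finset.mem_image.1 hz'
    rw [Finset.mem_range] at ha
    exact μ.isLowerSet (Prod.mk_le_mk.2 ⟨le_rfl, by omega⟩) hz
  have h3 := Finset.card_le_card h1
  have h4 := Finset.card_le_card h2
  rw [Finset.card_image_of_injective _ (fun a b e => (Prod.mk.inj e).1), Finset.card_range] at h3
  rw [Finset.card_image_of_injective _ (fun a b e => (Prod.mk.inj e).2), Finset.card_range] at h4
  change _ ≤ μ.card at h3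
  change _ ≤ μ.card at h4
  simp only [Finset.mem_product, Finset.mem_range]
  omega

theorem finite_partitePartitions (n r : ℕ) :
    {lam : Fin r → YoungDiagram | ∑ j, (lam j).card = n}.Finite := by
  refine Set.Finite.of_injOn (f := fun lam j => (lam j).cells)
    (t := ↑(Fintype.piFinset fun _ : Fin r => (Finset.range n ×ˢ Finset.range n).powerset))
    ?_ ?_ (Finset.finite_toSet _)
  · intro lam hlam
    simp only [Finset.mem_coe, Fintype.mem_piFinset, Finset.mem_powerset]
    intro j
    refine YoungDiagram.cells_subset ?_
    rw [← (hlam : _ = n)]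
    exact Finset.single_le_sum (f := fun j => (lam j).card) (fun _ _ => Nat.zero_le _)
      (Finset.mem_univ j)
  · intro lam _ lam' _ e
    exact funext fun j => YoungDiagram.ext (congrFun e j)

end Content

/-- For every `r`-colored composition `(α,ε)` of `n` (given
as the list `l` of colored parts), the colored ribbon Schur function expands
Schur-positively as `r_{(α,ε)} = Σ_{𝛌 ⊢ n} c_𝛌(α,ε) s_𝛌`, where the sum is
over all `r`-partite partitions `𝛌` of `n` and `c_𝛌(α,ε)` is the number of
standard Young `r`-partite tableaux of shape `𝛌` with colored descent
composition `(α,ε)`. -/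
theorem statement13 (n r : ℕ) (hn : 0 < n) [NeZero r] (l : List (ℕ × Fin r))
    (hpos : ∀ p ∈ l, 0 < p.1) (hsum : (l.map Prod.fst).sum = n) :
    colRibbon l =
      ∑ᶠ (lam : Fin r → YoungDiagram) (_ : ∑ j, (lam j).card = n),
        ({T : Fin r → ℤ × ℤ → ℕ |
            IsPartiteSYT (shOf lam) n T ∧ coTab (shOf lam) n T = l}.ncard) •
          ∏ j, skewSchurIn j (shOf lam j) := by
  classical
  have hfin := finite_partitePartitions n r
  rw [finsum_cond_eq_sum_of_cond_iff _ (t := hfin.toFinset) (by simp)]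
  ext d
  obtain ⟨N, hd⟩ : ∃ N, ∀ x, d x ≠ 0 → x.2 < N :=
    ⟨d.support.sup (fun x => x.2 + 1), fun x hx =>
      Finset.le_sup (f := fun x : Fin r × ℕ => x.2 + 1) (Finsupp.mem_support_iff.2 hx)⟩
  obtain ⟨hWfin, hW⟩ := coeff_colRibbon hpos d
  choose! shape hshape hrow using
    fun w (hw : w ∈ descentWords d l) => exists_shape hd hpos hsum hw
  rw [hW, map_sum, Set.ncard_eq_toFinset_card _ hWfin, Finset.card_eq_sum_card_fiberwise
    (f := shape) (t := hfin.toFinset) fun w hw => by simpa using hshape w (by simpa using hw)]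
  push_cast
  refine Finset.sum_congr rfl fun lam _ => ?_
  rw [map_nsmul, coeff_prod_skewSchurIn hd, nsmul_eq_mul, ← Nat.cast_mul,
    ← ncard_descentWords_shape hd hpos hsum, ← Set.ncard_coe_finset]
  congr 2
  ext w
  simp only [Finset.coe_filter, Set.Finite.mem_toFinset, Set.mem_ofPred_eq]
  refine and_congr_right fun hw => ⟨?_, fun h => ?_⟩
  · rintro rfl
    exact hrow w hw
  · exact funext fun j => YoungDiagram.eq_of_rowLen_eq fun i => by rw [← hrow w hw, h]
end

section
/- For every r-colored composition (α,ε) of n, the colored ribbon Schur function satisfies the alternating formula r_{(α,ε)} = Σ_{(β,δ) ⪯ (α,ε)} (-1)^{ℓ(α) - ℓ(β)} h_{(β,δ)}, where the sum is over all r-colored compositions (β,δ) of n coarser than (α,ε) in the reverse refinement order on colored compositions. -/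
/-- The extended color vector of a colored composition: each color is repeated
as many times as the size of its part. -/
def colorWord {r : ℕ} (l : List (ℕ × Fin r)) : List (Fin r) :=
  (l.map fun p => List.replicate p.1 p.2).flatten

/-- Poirier's colored fundamental quasisymmetric function `F^{(r)}_{(α,ε)}`
associated with the colored composition `l` of `n`, in the `r` sets of
variables `x^{(j)}_i` indexed by `Fin r × ℕ`: the sum over all weakly
increasing `i₁ ≤ … ≤ i_n` which increase strictly at every partial sum
`r_j = α₁ + … + α_j` with `ε_j ≥ ε_{j+1}`, of
`x^{(ε̃₁)}_{i_1} ⋯ x^{(ε̃_n)}_{i_n}` where `ε̃` is the extended color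
vector. -/
noncomputable def Fcol {r : ℕ} [NeZero r] (n : ℕ) (l : List (ℕ × Fin r)) :
    MvPowerSeries (Fin r × ℕ) ℤ := fun d =>
  (({i : Fin n → ℕ |
      Monotone i ∧
      (∀ k, k + 1 < l.length → (l.getD (k + 1) (1, 0)).2 ≤ (l.getD k (1, 0)).2 →
        ∀ (h1 : 1 ≤ ((l.take (k + 1)).map Prod.fst).sum)
          (h2 : ((l.take (k + 1)).map Prod.fst).sum < n),
          i ⟨((l.take (k + 1)).map Prod.fst).sum - 1, by omega⟩ <
            i ⟨((l.take (k + 1)).map Prod.fst).sum, h2⟩) ∧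
      (∑ t : Fin n, Finsupp.single ((colorWord l).getD (t : ℕ) 0, i t) 1) = d}).ncard : ℤ)
/-- The set of partial sums of a colored composition, excluding the total sum
(the colored subset of `[n-1]` corresponding to `l`, forgetting colors). -/
def cInnerSums {r : ℕ} (l : List (ℕ × Fin r)) : Set ℕ :=
  {m | ∃ k, k + 1 < l.length ∧ m = ((l.take (k + 1)).map Prod.fst).sum}

/-- The reverse refinement order on `r`-colored compositions, in which only
consecutive parts of equal color may be merged: `b ⪯ a` iff `a` and `b` have
the same extended color vector and the partial-sum set of `b` is contained in
that of `a`. -/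
def coarserC {r : ℕ} (b a : List (ℕ × Fin r)) : Prop :=
  colorWord b = colorWord a ∧ cInnerSums b ⊆ cInnerSums a
/-- The complete homogeneous symmetric function `h_m(x^{(j)})` in the variables
of color `j`. -/
noncomputable def hIn {r : ℕ} (j : Fin r) (m : ℕ) : MvPowerSeries (Fin r × ℕ) ℤ :=
  fun d =>
    (({i : Fin m → ℕ |
        Monotone i ∧ (∑ t : Fin m, Finsupp.single (j, i t) 1) = d}).ncard : ℤ)

/-- The elementary symmetric function `e_m(x^{(j)})` in the variables of
color `j`. -/
noncomputable def eIn {r : ℕ} (j : Fin r) (m : ℕ) : MvPowerSeries (Fin r × ℕ) ℤ :=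
  fun d =>
    (({i : Fin m → ℕ |
        StrictMono i ∧ (∑ t : Fin m, Finsupp.single (j, i t) 1) = d}).ncard : ℤ)

/-- `h_{(β,δ)} = h_{β₁}(x^{(δ₁)}) ⋯ h_{β_k}(x^{(δ_k)})` for a colored
composition given by the list `b` of colored parts. -/
noncomputable def hColored {r : ℕ} (b : List (ℕ × Fin r)) :
    MvPowerSeries (Fin r × ℕ) ℤ :=
  (b.map fun p => hIn p.2 p.1).prod

/-- The exponent vector of the monomial `∏ x^{(j)}_i` over the letters `i` of a word. -/
noncomputable def wordWeight {r : ℕ} (j : Fin r) (w : List ℕ) : Fin r × ℕ →₀ ℕ :=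
  (w.map fun x => Finsupp.single (j, x) 1).sum

/-- The generating function of a set of words in the variables of color `j`. -/
noncomputable def wordSeries {r : ℕ} (j : Fin r) (A : Set (List ℕ)) :
    MvPowerSeries (Fin r × ℕ) ℤ :=
  fun d => (({w | w ∈ A ∧ wordWeight j w = d}).ncard : ℤ)

/-- The words obtained from the rows of a ribbon, read from bottom to top: each row is weakly
increasing, and there is a strict descent between consecutive rows. -/
def ribbonWords : List ℕ → Set (List ℕ)
  | [] => {[]}
  | a :: rest => {w | ∃ u v, w = u ++ v ∧ u.length = a ∧ u.IsChain (· ≤ ·) ∧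
      v ∈ ribbonWords rest ∧ ∀ x ∈ u.getLast?, ∀ y ∈ v.head?, y < x}

section WordSeries

variable {r : ℕ} (j : Fin r)

theorem wordWeight_append (u v : List ℕ) :
    wordWeight j (u ++ v) = wordWeight j u + wordWeight j v := by
  simp [wordWeight]

theorem wordWeight_apply (w : List ℕ) (x : ℕ) : wordWeight j w (j, x) = w.count x := by
  induction w with
  | nil => simp [wordWeight]
  | cons y w ih =>
    have h : wordWeight j (y :: w) = Finsupp.single (j, y) 1 + wordWeight j w := by
      simp [wordWeight]
    rw [h, Finsupp.add_apply, ih, List.count_cons, add_comm, Finsupp.single_apply]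
    simp

theorem finite_wordWeight_eq (d : Fin r × ℕ →₀ ℕ) : {w | wordWeight j w = d}.Finite := by
  rcases Set.eq_empty_or_nonempty {w | wordWeight j w = d} with h | ⟨w₀, h₀⟩
  · simp [h]
  · refine (List.finite_toSet w₀.permutations).subset fun w hw => ?_
    have h₀ : wordWeight j w₀ = d := h₀
    have hw : wordWeight j w = d := hw
    simp only [Set.mem_ofPred_eq, List.mem_permutations]
    rw [List.perm_iff_count]
    intro x
    rw [← wordWeight_apply j, ← wordWeight_apply j, hw, h₀]

theorem finite_wordSeries (A : Set (List ℕ)) (d : Fin r × ℕ →₀ ℕ) :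
    {w | w ∈ A ∧ wordWeight j w = d}.Finite :=
  (finite_wordWeight_eq j d).subset fun _ h => h.2

theorem wordSeries_union {A B : Set (List ℕ)} (h : Disjoint A B) :
    wordSeries j (A ∪ B) = wordSeries j A + wordSeries j B := by
  ext d
  rw [map_add]
  change ((Set.ncard _ : ℕ) : ℤ) = ((Set.ncard _ : ℕ) : ℤ) + ((Set.ncard _ : ℕ) : ℤ)
  rw [← Nat.cast_add, ← Set.ncard_union_eq _ (finite_wordSeries j A d) (finite_wordSeries j B d)]
  · congr 2
    ext w
    simp only [Set.mem_union, Set.mem_ofPred_eq]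
    tauto
  · exact Set.disjoint_left.2 fun w hA hB => Set.disjoint_left.1 h hA.1 hB.1

theorem wordSeries_mul {A : Set (List ℕ)} (B : Set (List ℕ)) {a : ℕ}
    (hA : ∀ u ∈ A, u.length = a) :
    wordSeries j A * wordSeries j B = wordSeries j (Set.image2 (· ++ ·) A B) := by
  classical
  ext d
  rw [MvPowerSeries.coeff_mul]
  change (∑ p ∈ Finset.HasAntidiagonal.antidiagonal d, (({w | w ∈ A ∧ wordWeight j w = p.1}).ncard : ℤ) *
    (({w | w ∈ B ∧ wordWeight j w = p.2}).ncard : ℤ)) = (_ : ℤ)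
  simp_rw [← Nat.cast_mul, ← Set.ncard_prod]
  have key : {w | w ∈ Set.image2 (· ++ ·) A B ∧ wordWeight j w = d} =
      (fun q : List ℕ × List ℕ => q.1 ++ q.2) ''
        ⋃ p ∈ Finset.HasAntidiagonal.antidiagonal d, {w | w ∈ A ∧ wordWeight j w = p.1} ×ˢ
          {w | w ∈ B ∧ wordWeight j w = p.2} := by
    ext w
    simp only [Set.mem_ofPred_eq, Set.mem_image2, Set.mem_image, Set.mem_iUnion, Set.mem_prod,
      Finset.HasAntidiagonal.mem_antidiagonal, exists_prop, Prod.exists]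
    constructor
    · rintro ⟨⟨u, hu, v, hv, rfl⟩, h⟩
      exact ⟨u, v, ⟨_, _, by rw [← h, wordWeight_append], ⟨hu, rfl⟩, hv, rfl⟩, rfl⟩
    · rintro ⟨u, v, ⟨_, _, h, ⟨hu, rfl⟩, hv, rfl⟩, rfl⟩
      exact ⟨⟨u, hu, v, hv, rfl⟩, by rw [wordWeight_append, h]⟩
  change _ = (({w | w ∈ Set.image2 (· ++ ·) A B ∧ wordWeight j w = d}).ncard : ℤ)
  rw [key, Set.InjOn.ncard_image, ← Nat.cast_sum]
  · congr 1
    have hfin : ∀ p : (Fin r × ℕ →₀ ℕ) × (Fin r × ℕ →₀ ℕ),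
        ({w | w ∈ A ∧ wordWeight j w = p.1} ×ˢ {w | w ∈ B ∧ wordWeight j w = p.2}).Finite :=
      fun p => (finite_wordSeries j A _).prod (finite_wordSeries j B _)
    have hcoe : (⋃ p ∈ Finset.HasAntidiagonal.antidiagonal d, {w | w ∈ A ∧ wordWeight j w = p.1} ×ˢ
          {w | w ∈ B ∧ wordWeight j w = p.2}) =
        (((Finset.HasAntidiagonal.antidiagonal d).biUnion fun p => (hfin p).toFinset : Finset _) :
          Set (List ℕ × List ℕ)) := by
      ext; simp
    rw [hcoe, Set.ncard_coe_finset, Finset.card_biUnion]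
    · exact Finset.sum_congr rfl fun p _ => Set.ncard_eq_toFinset_card _ (hfin p)
    · intro p _ q _ hpq
      rw [Function.onFun, Finset.disjoint_left]
      intro w hp hq
      simp only [Set.Finite.mem_toFinset, Set.mem_prod, Set.mem_ofPred_eq] at hp hq
      exact hpq (Prod.ext (hp.1.2.symm.trans hq.1.2) (hp.2.2.symm.trans hq.2.2))
  · rintro ⟨u, v⟩ hx ⟨u', v'⟩ hy h
    simp only [Set.mem_iUnion, Set.mem_prod, Set.mem_ofPred_eq, exists_prop] at hx hy
    obtain ⟨_, _, hx, _⟩ := hx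
    obtain ⟨_, _, hy, _⟩ := hy
    have := List.append_inj h ((hA _ hx.1).trans (hA _ hy.1).symm)
    exact Prod.ext this.1 this.2

theorem ribbonWords_singleton (a : ℕ) :
    ribbonWords [a] = {u | u.length = a ∧ u.IsChain (· ≤ ·)} := by
  ext w
  simp [ribbonWords]

theorem hIn_eq_wordSeries (a : ℕ) : hIn j a = wordSeries j (ribbonWords [a]) := by
  funext d
  rw [ribbonWords_singleton]
  change ((Set.ncard _ : ℕ) : ℤ) = ((Set.ncard _ : ℕ) : ℤ)
  rw [← Set.InjOn.ncard_image (List.ofFn_injective (n := a)).injOn]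
  congr 2
  ext w
  simp only [Set.mem_image, Set.mem_ofPred_eq]
  constructor
  · rintro ⟨i, ⟨hi, rfl⟩, rfl⟩
    refine ⟨⟨by simp, hi.sortedLE_ofFn.isChain⟩, ?_⟩
    simp [wordWeight, List.map_ofFn, List.sum_ofFn]
  · rintro ⟨⟨rfl, hc⟩, rfl⟩
    refine ⟨w.get, ⟨?_, ?_⟩, List.ofFn_get w⟩
    · rw [← List.sortedLE_ofFn_iff, List.ofFn_get]
      exact List.sortedLE_iff_isChain.2 hc
    · conv_rhs => rw [← List.ofFn_get w]
      simp [-List.ofFn_get, -List.ofFn_getElem, wordWeight, List.map_ofFn, List.sum_ofFn]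

theorem mem_ribbonWords_add_cons {a b : ℕ} (hb : 0 < b) (bs w : List ℕ) :
    w ∈ ribbonWords ((a + b) :: bs) ↔ ∃ u v, w = u ++ v ∧ u.length = a ∧ u.IsChain (· ≤ ·) ∧
      v ∈ ribbonWords (b :: bs) ∧ ∀ x ∈ u.getLast?, ∀ y ∈ v.head?, x ≤ y := by
  constructor
  · rintro ⟨u, v, rfl, hu, hc, hv, hd⟩
    obtain ⟨u₁, u₂, rfl, h₁⟩ : ∃ u₁ u₂, u = u₁ ++ u₂ ∧ u₁.length = a :=
      ⟨u.take a, u.drop a, by simp, by simp; omega⟩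
    have h₂ : u₂.length = b := by simp at hu; omega
    have hne : u₂ ≠ [] := by rintro rfl; simp at h₂; omega
    rw [List.isChain_append] at hc
    refine ⟨u₁, u₂ ++ v, by simp, h₁, hc.1, ⟨u₂, v, rfl, h₂, hc.2.1, hv, ?_⟩, ?_⟩
    · rwa [List.getLast?_append_of_ne_nil _ hne] at hd
    · rw [List.head?_append_of_ne_nil _ hne]
      exact hc.2.2
  · rintro ⟨u₁, _, rfl, h₁, hc, ⟨u₂, v, rfl, h₂, hc₂, hv, hd⟩, hx⟩
    have hne : u₂ ≠ [] := by rintro rfl; simp at h₂; omega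
    rw [List.head?_append_of_ne_nil _ hne] at hx
    refine ⟨u₁ ++ u₂, v, by simp, by simp [h₁, h₂], List.isChain_append.2 ⟨hc, hc₂, hx⟩, hv, ?_⟩
    rwa [List.getLast?_append_of_ne_nil _ hne]

theorem wordSeries_ribbonWords_mul {a b : ℕ} (ha : 0 < a) (hb : 0 < b) (bs : List ℕ) :
    hIn j a * wordSeries j (ribbonWords (b :: bs)) =
      wordSeries j (ribbonWords (a :: b :: bs)) + wordSeries j (ribbonWords ((a + b) :: bs)) := by
  rw [hIn_eq_wordSeries, wordSeries_mul (a := a), ← wordSeries_union]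
  · congr 1
    ext w
    rw [Set.mem_union, mem_ribbonWords_add_cons hb, ribbonWords_singleton]
    change _ ↔ (∃ u v, w = u ++ v ∧ u.length = a ∧ u.IsChain (· ≤ ·) ∧
      v ∈ ribbonWords (b :: bs) ∧ ∀ x ∈ u.getLast?, ∀ y ∈ v.head?, y < x) ∨ _
    constructor
    · rintro ⟨u, ⟨hu, hc⟩, v, hv, rfl⟩
      by_cases h : ∀ x ∈ u.getLast?, ∀ y ∈ v.head?, y < x
      · exact Or.inl ⟨u, v, rfl, hu, hc, hv, h⟩
      · refine Or.inr ⟨u, v, rfl, hu, hc, hv, ?_⟩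
        push Not at h
        obtain ⟨x, hx, y, hy, hxy⟩ := h
        intro x' hx' y' hy'
        rw [Option.mem_unique hx' hx, Option.mem_unique hy' hy]
        exact hxy
    · rintro (⟨u, v, rfl, hu, hc, hv, -⟩ | ⟨u, v, rfl, hu, hc, hv, -⟩) <;>
      exact ⟨u, ⟨hu, hc⟩, v, hv, rfl⟩
  · rw [Set.disjoint_left]
    rintro w ⟨u, v, rfl, hu, hc, hv, hd⟩ hw
    obtain ⟨u', v', he, hu', -, -, hd'⟩ := (mem_ribbonWords_add_cons hb _ _).1 hw
    obtain ⟨rfl, rfl⟩ := List.append_inj he (hu.trans hu'.symm)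
    have hu0 : u ≠ [] := by rintro rfl; simp at hu; omega
    have hv0 : v ≠ [] := by
      obtain ⟨p, q, rfl, hp, -⟩ := hv
      rintro h
      simp only [List.append_eq_nil_iff] at h
      simp [h.1] at hp
      omega
    have h₁ := hd _ (List.getLast?_eq_getLast_of_ne_nil hu0) _ (List.head?_eq_some_head hv0)
    have h₂ := hd' _ (List.getLast?_eq_getLast_of_ne_nil hu0) _ (List.head?_eq_some_head hv0)
    omega
  · rw [ribbonWords_singleton]
    exact fun u hu => hu.1

end WordSeries

/-- The cells of a ribbon in reading order: rows from bottom to top, each from left to right. -/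
def ribbonCells : List ℕ → ℤ × ℤ → List (ℤ × ℤ)
  | [], _ => []
  | a :: rest, p =>
      ((List.range a).map fun j : ℕ => (p.1, p.2 + (j : ℤ))) ++
        ribbonCells rest (p.1 - 1, p.2 + (a : ℤ) - 1)

/-- The conditions for a filling of the cell set `D` to be semistandard. -/
def IsSemistandard (D : Finset (ℤ × ℤ)) (T : ℤ × ℤ → ℕ) : Prop :=
  (∀ c ∈ D, (c.1, c.2 + 1) ∈ D → T c ≤ T (c.1, c.2 + 1)) ∧
    (∀ c ∈ D, (c.1 + 1, c.2) ∈ D → T c < T (c.1 + 1, c.2))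

section Tableaux

theorem toFinset_ribbonCells (l : List ℕ) (p : ℤ × ℤ) :
    (ribbonCells l p).toFinset = ribbonAux l p := by
  induction l generalizing p with
  | nil => rfl
  | cons a rest ih =>
    rw [ribbonCells, ribbonAux, List.toFinset_append, ih]
    congr 1

theorem mem_ribbonAux_cons (a : ℕ) (rest : List ℕ) (p c : ℤ × ℤ) :
    c ∈ ribbonAux (a :: rest) p ↔ (c.1 = p.1 ∧ p.2 ≤ c.2 ∧ c.2 < p.2 + a) ∨
      c ∈ ribbonAux rest (p.1 - 1, p.2 + (a : ℤ) - 1) := by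
  rw [ribbonAux, Finset.mem_union, Finset.mem_image]
  refine or_congr_left ⟨?_, ?_⟩
  · rintro ⟨i, hi, rfl⟩
    rw [Finset.mem_range] at hi
    refine ⟨rfl, ?_, ?_⟩ <;> dsimp only <;> omega
  · rintro ⟨h₁, h₂, h₃⟩
    refine ⟨(c.2 - p.2).toNat, ?_, Prod.ext h₁.symm ?_⟩
    · rw [Finset.mem_range]
      omega
    · simp only
      omega

theorem le_of_mem_ribbonAux {l : List ℕ} (hl : ∀ a ∈ l, 0 < a) {p c : ℤ × ℤ}
    (hc : c ∈ ribbonAux l p) : c.1 ≤ p.1 ∧ p.2 ≤ c.2 := by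
  induction l generalizing p with
  | nil => simp [ribbonAux] at hc
  | cons a rest ih =>
    rw [mem_ribbonAux_cons] at hc
    have ha := hl a (by simp)
    rcases hc with h | h
    · omega
    · have := ih (fun x hx => hl x (by simp [hx])) h
      simp only at this
      omega

theorem nodup_ribbonCells {l : List ℕ} (hl : ∀ a ∈ l, 0 < a) (p : ℤ × ℤ) :
    (ribbonCells l p).Nodup := by
  induction l generalizing p with
  | nil => simp [ribbonCells]
  | cons a rest ih =>
    have hrest : ∀ x ∈ rest, 0 < x := fun x hx => hl x (by simp [hx])
    rw [ribbonCells, List.nodup_append']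
    refine ⟨List.Nodup.map ?_ List.nodup_range, ih hrest _, ?_⟩
    · intro i k h
      simpa using h
    · intro c hc hc'
      rw [← List.mem_toFinset, toFinset_ribbonCells] at hc'
      have := le_of_mem_ribbonAux hrest hc'
      simp only [List.mem_map] at hc
      obtain ⟨i, -, rfl⟩ := hc
      simp only at this
      omega

theorem length_ribbonCells (l : List ℕ) (p : ℤ × ℤ) : (ribbonCells l p).length = l.sum := by
  induction l generalizing p with
  | nil => rfl
  | cons a rest ih => simp [ribbonCells, ih]

theorem length_of_mem_ribbonWords {l w : List ℕ} (hw : w ∈ ribbonWords l) :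
    w.length = l.sum := by
  induction l generalizing w with
  | nil =>
    have hw : w = [] := hw
    simp [hw]
  | cons a rest ih =>
    obtain ⟨u, v, rfl, rfl, -, hv, -⟩ := hw
    simp [ih hv]

theorem isSemistandard_ribbonAux_cons {a : ℕ} (ha : 0 < a) {rest : List ℕ}
    (hrest : ∀ x ∈ rest, 0 < x) (p : ℤ × ℤ) (T : ℤ × ℤ → ℕ) :
    IsSemistandard (ribbonAux (a :: rest) p) T ↔
      (∀ i : ℕ, i + 1 < a → T (p.1, p.2 + i) ≤ T (p.1, p.2 + (i + 1 : ℕ))) ∧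
      IsSemistandard (ribbonAux rest (p.1 - 1, p.2 + (a : ℤ) - 1)) T ∧
      (rest ≠ [] → T (p.1 - 1, p.2 + (a : ℤ) - 1) < T (p.1, p.2 + (a : ℤ) - 1)) := by
  have hle := fun c (hc : c ∈ ribbonAux rest (p.1 - 1, p.2 + (a : ℤ) - 1)) =>
    le_of_mem_ribbonAux hrest hc
  simp only at hle
  constructor
  · rintro ⟨h₁, h₂⟩
    refine ⟨fun i hi => ?_, ⟨fun c hc hc' => ?_, fun c hc hc' => ?_⟩, fun hne => ?_⟩
    · have := h₁ (p.1, p.2 + i) ?_ ?_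
      · simpa [add_assoc] using this
      all_goals
        rw [mem_ribbonAux_cons]
        left
        refine ⟨rfl, ?_, ?_⟩ <;> dsimp only <;> omega
    · exact h₁ c ((mem_ribbonAux_cons ..).2 (Or.inr hc)) ((mem_ribbonAux_cons ..).2 (Or.inr hc'))
    · exact h₂ c ((mem_ribbonAux_cons ..).2 (Or.inr hc)) ((mem_ribbonAux_cons ..).2 (Or.inr hc'))
    · have := h₂ (p.1 - 1, p.2 + (a : ℤ) - 1) ?_ ?_
      · simpa using this
      · rw [mem_ribbonAux_cons]
        right
        obtain ⟨b, bs, rfl⟩ := List.exists_cons_of_ne_nil hne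
        have := hrest b (by simp)
        rw [mem_ribbonAux_cons]
        left
        refine ⟨rfl, ?_, ?_⟩ <;> dsimp only <;> omega
      · rw [mem_ribbonAux_cons]
        left
        refine ⟨by simp, ?_, ?_⟩ <;> dsimp only <;> omega
  · rintro ⟨hrow, ⟨h₁, h₂⟩, hdesc⟩
    refine ⟨fun c hc hc' => ?_, fun c hc hc' => ?_⟩
    · rw [mem_ribbonAux_cons] at hc hc'
      rcases hc with hc | hc <;> rcases hc' with hc' | hc'
      · simp only at hc'
        have := hrow (c.2 - p.2).toNat (by omega)
        have e₁ : (p.1, p.2 + ((c.2 - p.2).toNat : ℤ)) = c :=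
          Prod.ext hc.1.symm (by simp only; omega)
        have e₂ : (p.1, p.2 + (((c.2 - p.2).toNat + 1 : ℕ) : ℤ)) = (c.1, c.2 + 1) :=
          Prod.ext hc.1.symm (by simp only; omega)
        rwa [e₁, e₂] at this
      · have := hle _ hc'
        simp only at this
        omega
      · have := hle _ hc
        simp only at hc'
        omega
      · exact h₁ c hc hc'
    · rw [mem_ribbonAux_cons] at hc hc'
      rcases hc with hc | hc <;> rcases hc' with hc' | hc'
      · simp only at hc'
        omega
      · have := hle _ hc'
        simp only at this
        omega
      · have := hle _ hc
        simp only at hc'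
        have e₁ : (p.1 - 1, p.2 + (a : ℤ) - 1) = c :=
          Prod.ext (by simp only; omega) (by simp only; omega)
        have e₂ : (p.1, p.2 + (a : ℤ) - 1) = (c.1 + 1, c.2) :=
          Prod.ext (by simp only; omega) (by simp only; omega)
        rw [e₁, e₂] at hdesc
        refine hdesc ?_
        rintro rfl
        simp [ribbonAux] at hc
      · exact h₂ c hc hc'

theorem map_ribbonCells_mem_ribbonWords {l : List ℕ} (hl : ∀ a ∈ l, 0 < a) (p : ℤ × ℤ)
    (T : ℤ × ℤ → ℕ) :
    (ribbonCells l p).map T ∈ ribbonWords l ↔ IsSemistandard (ribbonAux l p) T := by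
  induction l generalizing p with
  | nil => simp [ribbonCells, ribbonAux, ribbonWords, IsSemistandard]
  | cons a rest ih =>
    have ha : 0 < a := hl a (by simp)
    have hrest : ∀ x ∈ rest, 0 < x := fun x hx => hl x (by simp [hx])
    rw [isSemistandard_ribbonAux_cons ha hrest, ← ih hrest, ribbonCells, List.map_append]
    set u := ((List.range a).map fun j : ℕ => (p.1, p.2 + (j : ℤ))).map T with hu
    set v := (ribbonCells rest (p.1 - 1, p.2 + (a : ℤ) - 1)).map T with hv
    have hlen : u.length = a := by simp [hu]
    have hsplit : u ++ v ∈ ribbonWords (a :: rest) ↔ u.IsChain (· ≤ ·) ∧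
        v ∈ ribbonWords rest ∧ ∀ x ∈ u.getLast?, ∀ y ∈ v.head?, y < x := by
      constructor
      · rintro ⟨u', v', he, hu', h⟩
        obtain ⟨rfl, rfl⟩ := List.append_inj he (hlen.trans hu'.symm)
        exact h
      · exact fun h => ⟨u, v, rfl, hlen, h⟩
    rw [hsplit]
    refine and_congr ?_ (and_congr_right fun _ => ?_)
    · rw [hu, List.map_map, List.isChain_map, List.isChain_range]
      refine forall_congr' fun i => imp_congr (by omega) ?_
      simp
    · have hlast : u.getLast? = some (T (p.1, p.2 + (a : ℤ) - 1)) := by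
        obtain ⟨k, rfl⟩ : ∃ k, a = k + 1 := ⟨a - 1, by omega⟩
        simp [hu, List.range_succ, ← add_assoc]
      have hhead : v.head? = if rest = [] then none else
          some (T (p.1 - 1, p.2 + (a : ℤ) - 1)) := by
        cases rest with
        | nil => simp [hv, ribbonCells]
        | cons b bs =>
          obtain ⟨k, rfl⟩ : ∃ k, b = k + 1 := ⟨b - 1, by have := hrest b (by simp); omega⟩
          simp [hv, ribbonCells, List.range_succ_eq_map]
      rw [hlast, hhead]
      by_cases h : rest = [] <;> simp [h]

theorem skewSchurIn_ribbonOfList {r : ℕ} (j : Fin r) {l : List ℕ} (hl : ∀ a ∈ l, 0 < a) :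
    skewSchurIn j (ribbonOfList l) = wordSeries j (ribbonWords l) := by
  funext d
  change ((Set.ncard _ : ℕ) : ℤ) = ((Set.ncard _ : ℕ) : ℤ)
  set cells := ribbonCells l (0, 0) with hcells
  have hnd : cells.Nodup := nodup_ribbonCells hl _
  have hD : ribbonOfList l = cells.toFinset := (toFinset_ribbonCells l (0, 0)).symm
  have hweight : ∀ T : ℤ × ℤ → ℕ, (∑ c ∈ ribbonOfList l, Finsupp.single (j, T c) 1) =
      wordWeight j (cells.map T) := by
    intro T
    rw [hD, List.sum_toFinset _ hnd, wordWeight, List.map_map]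
    rfl
  congr 1
  refine Set.ncard_congr (fun T _ => cells.map T) ?_ ?_ ?_
  · rintro T ⟨-, h₁, h₂, h₃⟩
    exact ⟨(map_ribbonCells_mem_ribbonWords hl _ T).2 ⟨h₁, h₂⟩, by rw [← hweight, h₃]⟩
  · rintro T T' ⟨h, -⟩ ⟨h', -⟩ he
    funext c
    by_cases hc : c ∈ cells
    · exact List.map_inj_left.1 he c hc
    · rw [h c (by simpa [hD] using hc), h' c (by simpa [hD] using hc)]
  · rintro w ⟨hw, rfl⟩
    have hlen : w.length = cells.length := by
      rw [length_of_mem_ribbonWords hw, hcells, length_ribbonCells]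
    let T : ℤ × ℤ → ℕ := fun c => if c ∈ cells then w.getD (cells.idxOf c) 0 else 0
    have hT : cells.map T = w := by
      refine List.ext_getElem (by simp [hlen]) fun i h₁ h₂ => ?_
      have hi : i < cells.length := by omega
      simp [T, hnd.idxOf_getElem i hi, h₂]
    have hss := (map_ribbonCells_mem_ribbonWords hl (0, 0) T).1 (by rw [← hcells, hT]; exact hw)
    refine ⟨T, ⟨fun c hc => ?_, hss.1, hss.2, ?_⟩, hT⟩
    · have : c ∉ cells := by simpa [hD] using hc
      simp [T, this]
    · rw [hweight, hT]

end Tableaux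

section ColoredRibbon

variable {r : ℕ}

theorem exists_rainbow_cons (c : Fin r) (rest : List (ℕ × Fin r)) :
    ∃ bs blocks, (∀ x ∈ bs, ∃ p ∈ rest, p.1 = x) ∧
      ∀ b, rainbow ((b, c) :: rest) = (b :: bs, c) :: blocks := by
  induction rest generalizing c with
  | nil => exact ⟨[], [], by simp, fun b => rfl⟩
  | cons q rest ih =>
    obtain ⟨b₀, c₀⟩ := q
    obtain ⟨bs, blocks, hbs, h⟩ := ih c₀
    by_cases hc : c = c₀
    · subst hc
      refine ⟨b₀ :: bs, blocks, ?_, fun b => ?_⟩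
      · intro x hx
        rcases List.mem_cons.1 hx with rfl | hx
        · exact ⟨(x, c), by simp, rfl⟩
        · obtain ⟨p, hp, hpx⟩ := hbs x hx
          exact ⟨p, by simp [hp], hpx⟩
      · rw [rainbow, h]
        simp
    · refine ⟨[], (b₀ :: bs, c₀) :: blocks, by simp, fun b => ?_⟩
      rw [rainbow, h]
      simp [hc]

theorem colRibbon_singleton {a : ℕ} (ha : 0 < a) (c : Fin r) : colRibbon [(a, c)] = hIn c a := by
  simp [colRibbon, rainbow, skewSchurIn_ribbonOfList c (l := [a]) (by simpa using ha),
    hIn_eq_wordSeries]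

theorem colRibbon_cons_of_ne {a : ℕ} (ha : 0 < a) {c c' : Fin r} (hc : c ≠ c') (b : ℕ)
    (rest : List (ℕ × Fin r)) :
    colRibbon ((a, c) :: (b, c') :: rest) = hIn c a * colRibbon ((b, c') :: rest) := by
  obtain ⟨bs, blocks, -, h⟩ := exists_rainbow_cons c' rest
  rw [← colRibbon_singleton ha, colRibbon, colRibbon, colRibbon, rainbow, h]
  simp [hc, rainbow]

theorem colRibbon_cons_same {a b : ℕ} (ha : 0 < a) (hb : 0 < b) (c : Fin r)
    {rest : List (ℕ × Fin r)} (hrest : ∀ p ∈ rest, 0 < p.1) :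
    colRibbon ((a, c) :: (b, c) :: rest) =
      hIn c a * colRibbon ((b, c) :: rest) - colRibbon ((a + b, c) :: rest) := by
  obtain ⟨bs, blocks, hbs, h⟩ := exists_rainbow_cons c rest
  have hbs : ∀ x ∈ bs, 0 < x := by
    intro x hx
    obtain ⟨p, hp, rfl⟩ := hbs x hx
    exact hrest p hp
  have h' : rainbow ((a, c) :: (b, c) :: rest) = (a :: b :: bs, c) :: blocks := by
    rw [rainbow, h]
    simp
  have h₁ : ∀ x ∈ b :: bs, 0 < x := by simpa using ⟨hb, hbs⟩
  have h₂ : ∀ x ∈ a :: b :: bs, 0 < x := by simpa using ⟨ha, hb, hbs⟩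
  have h₃ : ∀ x ∈ (a + b) :: bs, 0 < x := by simpa using ⟨Or.inl ha, hbs⟩
  rw [colRibbon, colRibbon, colRibbon, h, h, h']
  simp only [List.map_cons, List.prod_cons]
  rw [skewSchurIn_ribbonOfList c h₁, skewSchurIn_ribbonOfList c h₂,
    skewSchurIn_ribbonOfList c h₃, ← mul_assoc, wordSeries_ribbonWords_mul c ha hb]
  ring

end ColoredRibbon

section Coarsening

variable {r : ℕ}

theorem colorWord_cons (a : ℕ) (c : Fin r) (l : List (ℕ × Fin r)) :
    colorWord ((a, c) :: l) = List.replicate a c ++ colorWord l := by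
  simp [colorWord]

theorem length_colorWord (l : List (ℕ × Fin r)) :
    (colorWord l).length = (l.map Prod.fst).sum := by
  induction l with
  | nil => rfl
  | cons p l ih =>
    obtain ⟨a, c⟩ := p
    simp [colorWord_cons, ih]

theorem mem_cInnerSums_cons {p : ℕ × Fin r} {l : List (ℕ × Fin r)} {m : ℕ} :
    m ∈ cInnerSums (p :: l) ↔ l ≠ [] ∧ (m = p.1 ∨ ∃ k ∈ cInnerSums l, m = p.1 + k) := by
  constructor
  · rintro ⟨k, hk, rfl⟩
    simp only [List.length_cons, add_lt_add_iff_right] at hk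
    refine ⟨by rintro rfl; simp at hk, ?_⟩
    cases k with
    | zero => simp
    | succ k => exact Or.inr ⟨_, ⟨k, hk, rfl⟩, by simp⟩
  · rintro ⟨hl, rfl | ⟨_, ⟨k, hk, rfl⟩, rfl⟩⟩
    · exact ⟨0, by simpa using List.length_pos_iff.2 hl, by simp⟩
    · exact ⟨k + 1, by simpa using hk, by simp⟩

theorem pos_of_mem_cInnerSums {l : List (ℕ × Fin r)} (hl : ∀ p ∈ l, 0 < p.1) {m : ℕ}
    (hm : m ∈ cInnerSums l) : 0 < m := by
  cases l with
  | nil => obtain ⟨k, hk, -⟩ := hm; simp at hk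
  | cons p l =>
    have := hl p (by simp)
    obtain ⟨-, rfl | ⟨k, -, rfl⟩⟩ := mem_cInnerSums_cons.1 hm <;> omega

theorem mem_cInnerSums_merge {a b : ℕ} {c : Fin r} {rest : List (ℕ × Fin r)} {m : ℕ} :
    m ∈ cInnerSums ((a, c) :: (b, c) :: rest) ↔ m = a ∨ m ∈ cInnerSums ((a + b, c) :: rest) := by
  simp only [mem_cInnerSums_cons, ne_eq, reduceCtorEq, not_false_eq_true, true_and]
  refine or_congr_right ⟨?_, ?_⟩
  · rintro ⟨_, ⟨hr, rfl | ⟨k, hk, rfl⟩⟩, rfl⟩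
    · exact ⟨hr, Or.inl rfl⟩
    · exact ⟨hr, Or.inr ⟨k, hk, by ring⟩⟩
  · rintro ⟨hr, rfl | ⟨k, hk, rfl⟩⟩
    · exact ⟨b, ⟨hr, Or.inl rfl⟩, rfl⟩
    · exact ⟨b + k, ⟨hr, Or.inr ⟨k, hk, rfl⟩⟩, by ring⟩

/-- `b` is a colored composition coarser than `l`. -/
def IsCoarsening (b l : List (ℕ × Fin r)) : Prop :=
  (∀ p ∈ b, 0 < p.1) ∧ coarserC b l

theorem IsCoarsening.sum_eq {b l : List (ℕ × Fin r)} (h : IsCoarsening b l) :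
    (b.map Prod.fst).sum = (l.map Prod.fst).sum := by
  rw [← length_colorWord, ← length_colorWord, h.2.1]

theorem IsCoarsening.exists_cons {b l : List (ℕ × Fin r)} {a : ℕ} {c : Fin r} (ha : 0 < a)
    (h : IsCoarsening b ((a, c) :: l)) : ∃ x xs, b = (x, c) :: xs ∧ 0 < x := by
  cases b with
  | nil =>
    have := h.sum_eq
    simp at this
    omega
  | cons q xs =>
    obtain ⟨x, c'⟩ := q
    have hx : 0 < x := h.1 (x, c') (by simp)
    have hw := congrArg List.head? h.2.1
    simp only [colorWord_cons, List.head?_append, List.head?_replicate] at hw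
    rw [if_neg (by omega), if_neg (by omega)] at hw
    have : c' = c := by simpa using hw
    exact ⟨x, xs, by rw [this], hx⟩

theorem isCoarsening_singleton {b : List (ℕ × Fin r)} {a : ℕ} {c : Fin r} (ha : 0 < a) :
    IsCoarsening b [(a, c)] ↔ b = [(a, c)] := by
  constructor
  · intro h
    obtain ⟨x, xs, rfl, hx⟩ := h.exists_cons ha
    have hxs : xs = [] := by
      by_contra hne
      exact (mem_cInnerSums_cons.1 (h.2.2 (mem_cInnerSums_cons.2 ⟨hne, Or.inl rfl⟩))).1 rfl
    have := h.sum_eq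
    subst hxs
    simp at this
    rw [this]
  · rintro rfl
    exact ⟨by simpa using ha, rfl, subset_rfl⟩

theorem isCoarsening_cons_cons_iff {x a b : ℕ} {c c' : Fin r} {xs rest : List (ℕ × Fin r)}
    (ha : 0 < a) (hb : 0 < b) (hrest : ∀ p ∈ rest, 0 < p.1) :
    IsCoarsening ((x, c) :: xs) ((a, c) :: (b, c') :: rest) ↔
      (x = a ∧ IsCoarsening xs ((b, c') :: rest)) ∨
        (c = c' ∧ IsCoarsening ((x, c) :: xs) ((a + b, c) :: rest)) := by
  have hrest' : ∀ p ∈ (b, c') :: rest, 0 < p.1 := by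
    intro p hp
    rcases List.mem_cons.1 hp with rfl | hp
    exacts [hb, hrest p hp]
  constructor
  · intro h
    have hsum := h.sum_eq
    obtain ⟨hpos, hword, hsub⟩ := h
    have hxpos : 0 < x := hpos (x, c) (by simp)
    have hxs : ∀ p ∈ xs, 0 < p.1 := fun p hp => hpos p (by simp [hp])
    simp only [List.map_cons, List.sum_cons] at hsum
    by_cases hxa : x = a
    · subst hxa
      refine Or.inl ⟨rfl, hxs, ?_, fun m hm => ?_⟩
      · rw [colorWord_cons x c xs, colorWord_cons x] at hword
        exact List.append_cancel_left hword
      · have hne : xs ≠ [] := by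
          rintro rfl
          obtain ⟨k, hk, -⟩ := hm
          simp at hk
        have := pos_of_mem_cInnerSums hxs hm
        have h₁ := (mem_cInnerSums_cons.1 (hsub (mem_cInnerSums_cons.2
          ⟨hne, Or.inr ⟨m, hm, rfl⟩⟩))).2
        rcases h₁ with h₁ | ⟨k, hk, h₁⟩
        · simp only at h₁
          omega
        · simp only at h₁
          obtain rfl : m = k := by omega
          exact hk
    · have hlt : a < x := by
        by_cases hne : xs = []
        · subst hne
          simp at hsum
          omega
        · have h₁ := (mem_cInnerSums_cons.1 (hsub (mem_cInnerSums_cons.2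
            ⟨hne, Or.inl rfl⟩))).2
          rcases h₁ with h₁ | ⟨k, hk, h₁⟩
          · exact absurd h₁ hxa
          · have := pos_of_mem_cInnerSums hrest' hk
            simp only at h₁
            omega
      have hcc : c = c' := by
        have := congrArg (fun w => w[a]?) hword
        simp only [colorWord_cons] at this
        rw [List.getElem?_append_left (by simpa using hlt),
          List.getElem?_append_right (by simp)] at this
        rw [List.getElem?_append_left (by simpa using hb)] at this
        simpa [hlt, hb] using this
      subst hcc
      refine Or.inr ⟨rfl, hpos, ?_, fun m hm => ?_⟩
      · rw [hword, colorWord_cons, colorWord_cons, colorWord_cons, List.replicate_add,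
          List.append_assoc]
      · refine (mem_cInnerSums_merge.1 (hsub hm)).resolve_left ?_
        rintro rfl
        rcases (mem_cInnerSums_cons.1 hm).2 with h₁ | ⟨k, -, h₁⟩ <;> simp only at h₁ <;> omega
  · rintro (⟨rfl, hpos, hword, hsub⟩ | ⟨rfl, hpos, hword, hsub⟩)
    · refine ⟨?_, ?_, fun m hm => ?_⟩
      · intro p hp
        rcases List.mem_cons.1 hp with rfl | hp
        exacts [ha, hpos p hp]
      · rw [colorWord_cons, hword, colorWord_cons x]
      · rw [mem_cInnerSums_cons] at hm ⊢
        refine ⟨by simp, hm.2.imp_right ?_⟩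
        rintro ⟨k, hk, rfl⟩
        exact ⟨k, hsub hk, rfl⟩
    · refine ⟨hpos, ?_, fun m hm => mem_cInnerSums_merge.2 (Or.inr (hsub hm))⟩
      rw [hword, colorWord_cons, colorWord_cons, colorWord_cons, List.replicate_add,
          List.append_assoc]

theorem IsCoarsening.head_ge {x a : ℕ} {c c' : Fin r} {xs rest : List (ℕ × Fin r)}
    (h : IsCoarsening ((x, c) :: xs) ((a, c') :: rest)) : a ≤ x := by
  have hsum := h.sum_eq
  simp only [List.map_cons, List.sum_cons] at hsum
  by_cases hne : xs = []
  · subst hne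
    simp at hsum
    omega
  · rcases (mem_cInnerSums_cons.1 (h.2.2 (mem_cInnerSums_cons.2 ⟨hne, Or.inl rfl⟩))).2
      with h₁ | ⟨k, -, h₁⟩ <;> simp only at h₁ <;> omega

theorem hColored_cons (a : ℕ) (c : Fin r) (l : List (ℕ × Fin r)) :
    hColored ((a, c) :: l) = hIn c a * hColored l := by
  simp [hColored]

theorem exists_finset_coarsenings (k : ℕ) (l : List (ℕ × Fin r)) (hk : l.length = k + 1)
    (hpos : ∀ p ∈ l, 0 < p.1) :
    ∃ s : Finset (List (ℕ × Fin r)), (∀ b, b ∈ s ↔ IsCoarsening b l) ∧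
      (∀ b ∈ s, b.length ≤ l.length) ∧
      ∑ b ∈ s, (-1 : ℤ) ^ (l.length - b.length) • hColored b = colRibbon l := by
  classical
  induction k generalizing l with
  | zero =>
    obtain ⟨⟨a, c⟩, rfl⟩ := List.length_eq_one_iff.1 hk
    have ha : 0 < a := hpos (a, c) (by simp)
    refine ⟨{[(a, c)]}, fun b => ?_, by simp, ?_⟩
    · rw [isCoarsening_singleton ha, Finset.mem_singleton]
    · simp [colRibbon_singleton ha, hColored]
  | succ k ih =>
    obtain ⟨⟨a, c⟩, ⟨b, c'⟩, rest, rfl⟩ : ∃ p q rest, l = p :: q :: rest := by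
      match l, hk with
      | p :: q :: rest, _ => exact ⟨p, q, rest, rfl⟩
    have ha : 0 < a := hpos (a, c) (by simp)
    have hb : 0 < b := hpos (b, c') (by simp)
    have hrest : ∀ p ∈ rest, 0 < p.1 := fun p hp => hpos p (by simp [hp])
    obtain ⟨s, hs, hslen, hsum⟩ := ih ((b, c') :: rest) (by simpa using hk)
      (fun p hp => hpos p (List.mem_cons_of_mem _ hp))
    have hinj : Set.InjOn (fun x => (a, c) :: x) (s : Set (List (ℕ × Fin r))) :=
      (List.cons_injective).injOn
    have hsum₁ : ∑ x ∈ s.image (fun x => (a, c) :: x),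
        (-1 : ℤ) ^ (((a, c) :: (b, c') :: rest).length - x.length) • hColored x =
          hIn c a * colRibbon ((b, c') :: rest) := by
      rw [Finset.sum_image hinj, ← hsum, Finset.mul_sum]
      refine Finset.sum_congr rfl fun x _ => ?_
      rw [hColored_cons, mul_smul_comm, List.length_cons, List.length_cons (as := x),
        Nat.add_sub_add_right]
    by_cases hc : c = c'
    · subst hc
      obtain ⟨t, ht, htlen, htsum⟩ := ih ((a + b, c) :: rest) (by simpa using hk) (by
        intro p hp
        rcases List.mem_cons.1 hp with rfl | hp
        exacts [Nat.add_pos_left ha b, hrest p hp])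
      have hdisj : Disjoint (s.image (fun x => (a, c) :: x)) t := by
        rw [Finset.disjoint_left]
        intro x hx hx'
        obtain ⟨y, -, rfl⟩ := Finset.mem_image.1 hx
        have := ((ht _).1 hx').head_ge
        omega
      refine ⟨s.image (fun x => (a, c) :: x) ∪ t, fun x => ?_, fun x hx => ?_, ?_⟩
      · rw [Finset.mem_union, Finset.mem_image, ht]
        constructor
        · rintro (⟨y, hy, rfl⟩ | hx)
          · exact (isCoarsening_cons_cons_iff ha hb hrest).2 (Or.inl ⟨rfl, (hs y).1 hy⟩)
          · obtain ⟨y, ys, rfl, -⟩ := hx.exists_cons (Nat.add_pos_left ha b)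
            exact (isCoarsening_cons_cons_iff ha hb hrest).2 (Or.inr ⟨rfl, hx⟩)
        · intro hx
          obtain ⟨y, ys, rfl, -⟩ := hx.exists_cons ha
          rcases (isCoarsening_cons_cons_iff ha hb hrest).1 hx with ⟨rfl, h⟩ | ⟨-, h⟩
          · exact Or.inl ⟨ys, (hs ys).2 h, rfl⟩
          · exact Or.inr h
      · rcases Finset.mem_union.1 hx with hx | hx
        · obtain ⟨y, hy, rfl⟩ := Finset.mem_image.1 hx
          simpa using hslen y hy
        · have := htlen x hx
          simp only [List.length_cons] at this ⊢
          omega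
      · rw [Finset.sum_union hdisj, hsum₁, colRibbon_cons_same ha hb c hrest, ← htsum,
          sub_eq_add_neg, ← Finset.sum_neg_distrib]
        congr 1
        refine Finset.sum_congr rfl fun x hx => ?_
        have := htlen x hx
        simp only [List.length_cons] at this ⊢
        rw [Nat.sub_add_comm this, pow_succ, mul_neg_one, neg_smul]
    · refine ⟨s.image (fun x => (a, c) :: x), fun x => ?_, fun x hx => ?_, ?_⟩
      · rw [Finset.mem_image]
        constructor
        · rintro ⟨y, hy, rfl⟩
          exact (isCoarsening_cons_cons_iff ha hb hrest).2 (Or.inl ⟨rfl, (hs y).1 hy⟩)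
        · intro hx
          obtain ⟨y, ys, rfl, -⟩ := hx.exists_cons ha
          rcases (isCoarsening_cons_cons_iff ha hb hrest).1 hx with ⟨rfl, h⟩ | ⟨h, -⟩
          · exact ⟨ys, (hs ys).2 h, rfl⟩
          · exact absurd h hc
      · obtain ⟨y, hy, rfl⟩ := Finset.mem_image.1 hx
        simpa using hslen y hy
      · rw [hsum₁, colRibbon_cons_of_ne ha hc]

end Coarsening

/-- For every `r`-colored composition `(α,ε)` of `n` (given
as the list `l` of colored parts), the colored ribbon Schur function satisfies
the alternating formula
`r_{(α,ε)} = Σ_{(β,δ) ⪯ (α,ε)} (-1)^{ℓ(α) - ℓ(β)} h_{(β,δ)}`,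
summed over all `r`-colored compositions `(β,δ)` of `n` coarser than `(α,ε)` in
the reverse refinement order on colored compositions. -/
theorem statement14 (n r : ℕ) (hn : 0 < n) [NeZero r] (l : List (ℕ × Fin r))
    (hpos : ∀ p ∈ l, 0 < p.1) (hsum : (l.map Prod.fst).sum = n) :
    colRibbon l =
      ∑ᶠ (b : List (ℕ × Fin r))
        (_ : (∀ p ∈ b, 0 < p.1) ∧ (b.map Prod.fst).sum = n ∧ coarserC b l),
        (-1 : ℤ) ^ (l.length - b.length) • hColored b := by
  obtain ⟨k, hk⟩ : ∃ k, l.length = k + 1 := by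
    cases l with
    | nil => simp at hsum; omega
    | cons p l => exact ⟨l.length, rfl⟩
  obtain ⟨s, hs, -, h⟩ := exists_finset_coarsenings k l hk hpos
  rw [← h, ← finsum_mem_coe_finset]
  refine finsum_congr fun b => finsum_congr_Prop (propext ?_) fun _ => rfl
  rw [Finset.mem_coe, hs]
  exact ⟨fun hb => ⟨hb.1, hb.sum_eq.trans hsum, hb.2⟩, fun hb => ⟨hb.1, hb.2.2⟩⟩
end
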